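/- arXiv:2603.07930 — 6 statements merged into one kernel-verified Lean document; each statement's English description precedes it below -/
import Mathlib

section
/- For every n ≥ 1, every ε > 0, and all functions f, g : {0,1}^n → {0,1}^n, if x and y are drawn independently and uniformly at random from {0,1}^n, then the probability that |{i ∈ [n] : f(x)_i XOR g(y)_i = x_i AND y_i}| ≥ ((1+√5)/4 + ε)·n is at most exp(−2ε²n). -/
open scoped Classical

/-- Number of CHSH copies won: `|{i : a_i ⊕ b_i = x_i ∧ y_i}|`. -/
noncomputable def winCount (n : ℕ) (a b x y : Fin n → Bool) : ℕ :=
  (Finset.univ.filter (fun i : Fin n => Bool.xor (a i) (b i) = (x i && y i))).card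

/-- Probability of an event over independent uniform `x, y ∈ {0,1}^n`. -/
noncomputable def prUniform (n : ℕ)
    (P : (Fin n → Bool) → (Fin n → Bool) → Prop) : ℝ :=
  ((Finset.univ.filter (fun p : (Fin n → Bool) × (Fin n → Bool) => P p.1 p.2)).card : ℝ)
    / (2 ^ n * 2 ^ n)

/-- Rounding rules on the 8-cycle: `turn b i` says whether the centre at offset `i` moves up. -/
def turn : Bool → Fin 8 → Bool
  | false => ![false, false, false, false, true, true, true, true]
  | true => ![true, false, true, false, false, true, false, true]

/-- Amplitudes attached to the rounding rules `turn`. -/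
def amplitude : Bool → Fin 8 → ℕ
  | false => ![31, 27, 23, 18, 18, 23, 27, 31]
  | true => ![22, 22, 22, 22, 19, 19, 19, 19]

/-- Position on the 8-cycle of Alice's pair of answers to the questions `0` and `1`. -/
def aliceCentre (a₀ a₁ : Bool) : Fin 8 :=
  if a₀ then (if a₁ then 3 else 5) else (if a₁ then 1 else 7)

/-- Position on the 8-cycle of Bob's pair of answers to the questions `0` and `1`. -/
def bobCentre (b₀ b₁ : Bool) : Fin 8 :=
  if b₀ then (if b₁ then 4 else 2) else (if b₁ then 6 else 0)

/-- The question selected for Alice by the rounding rule `j`. -/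
def aliceBit (j : Bool × Fin 8) (a : Bool → Bool) : Bool :=
  xor (turn j.1 (aliceCentre (a false) (a true) - j.2)) (a false == a true)

/-- The question selected for Bob by the rounding rule `j`. -/
def bobBit (j : Bool × Fin 8) (b : Bool → Bool) : Bool :=
  xor (turn j.1 (bobCentre (b false) (b true) - j.2)) (b false != b true)

/-- The amplitude given to Alice by the rounding rule `j`. -/
def aliceAmp (j : Bool × Fin 8) (a : Bool → Bool) : ℕ :=
  amplitude j.1 (aliceCentre (a false) (a true) - j.2)

/-- The amplitude given to Bob by the rounding rule `j`. -/
def bobAmp (j : Bool × Fin 8) (b : Bool → Bool) : ℕ :=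
  amplitude j.1 (bobCentre (b false) (b true) - j.2)

lemma sum_aliceAmp_sq (a : Bool → Bool) (s : Bool) :
    ∑ j, (if aliceBit j a = s then aliceAmp j a ^ 2 else 0) = 4233 := by
  unfold aliceBit aliceAmp
  generalize a false = a₀, a true = a₁
  decide +revert +kernel

lemma sum_bobAmp_sq (b : Bool → Bool) (t : Bool) :
    ∑ j, (if bobBit j b = t then bobAmp j b ^ 2 else 0) = 4233 := by
  unfold bobBit bobAmp
  generalize b false = b₀, b true = b₁
  decide +revert +kernel

lemma le_sum_aliceAmp_mul_bobAmp (a b : Bool → Bool) (s t : Bool) :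
    40 * 4233 * (if xor (a s) (b t) = (s && t) then 3 else 2) ≤
      111 * 2 * ∑ j, (if aliceBit j a = s ∧ bobBit j b = t then
        aliceAmp j a * bobAmp j b else 0) := by
  have h : ∀ a₀ a₁ b₀ b₁ s t : Bool,
      40 * 4233 * (if xor (if s then a₁ else a₀) (if t then b₁ else b₀) = (s && t)
        then 3 else 2) ≤
      111 * 2 * ∑ j : Bool × Fin 8,
        (if xor (turn j.1 (aliceCentre a₀ a₁ - j.2)) (a₀ == a₁) = s ∧
            xor (turn j.1 (bobCentre b₀ b₁ - j.2)) (b₀ != b₁) = t then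
          amplitude j.1 (aliceCentre a₀ a₁ - j.2) * amplitude j.1 (bobCentre b₀ b₁ - j.2)
        else 0) := by
    decide +kernel
  have := h (a false) (a true) (b false) (b true) s t
  cases s <;> cases t <;> exact this

lemma sum_mul_le_sum_of_cover {J : Type*} [Fintype J] (K R : Bool → Bool → ℝ)
    (hK : ∀ s t, 0 ≤ K s t) (φ ψ : J → Bool) (w : J → ℝ)
    (h : ∀ s t, R s t ≤ ∑ j, if φ j = s ∧ ψ j = t then w j else 0) :
    ∑ s, ∑ t, K s t * R s t ≤ ∑ j, K (φ j) (ψ j) * w j := by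
  calc ∑ s, ∑ t, K s t * R s t
      ≤ ∑ s, ∑ t, K s t * ∑ j, (if φ j = s ∧ ψ j = t then w j else 0) :=
        Finset.sum_le_sum fun s _ => Finset.sum_le_sum fun t _ =>
          mul_le_mul_of_nonneg_left (h s t) (hK s t)
    _ = ∑ j, ∑ s, ∑ t, K s t * (if φ j = s ∧ ψ j = t then w j else 0) := by
        simp only [Finset.mul_sum]
        rw [Finset.sum_comm (s := (Finset.univ : Finset J))]
        exact Finset.sum_congr rfl fun s _ => Finset.sum_comm
    _ = ∑ j, K (φ j) (ψ j) * w j := by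
        refine Finset.sum_congr rfl fun j _ => ?_
        cases φ j <;> cases ψ j <;> simp

lemma sum_fin_succ_bool {n : ℕ} (F : (Fin (n + 1) → Bool) → ℝ) :
    ∑ x, F x = ∑ x : Fin n → Bool, ∑ s, F (Fin.cons s x) := by
  rw [← (Fin.consEquiv fun _ : Fin (n + 1) => Bool).sum_comp, Fintype.sum_prod_type,
    Finset.sum_comm]
  rfl

lemma winCount_cons {n : ℕ} (a b : Fin (n + 1) → Bool) (s t : Bool) (x y : Fin n → Bool) :
    winCount (n + 1) a b (Fin.cons s x) (Fin.cons t y) =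
      (if xor (a 0) (b 0) = (s && t) then 1 else 0) +
        winCount n (Fin.tail a) (Fin.tail b) x y := by
  unfold winCount
  rw [Finset.card_filter, Finset.card_filter, Fin.sum_univ_succ]
  rfl

/-- Sum of squares of a function pulled back along the selected first questions. -/
lemma sum_sum_sq_select {J : Type*} [Fintype J] {n : ℕ} (u : (Fin (n + 1) → Bool) → ℝ)
    (φ : J → (Fin n → Bool) → Bool) (α : J → (Fin n → Bool) → ℕ) (S : ℕ)
    (h : ∀ x s, ∑ j, (if φ j x = s then α j x ^ 2 else 0) = S) :
    ∑ j, ∑ x, (u (Fin.cons (φ j x) x) * α j x) ^ 2 = S * ∑ x, u x ^ 2 := by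
  rw [sum_fin_succ_bool, Finset.sum_comm, Finset.mul_sum]
  refine Finset.sum_congr rfl fun x _ => ?_
  have h' : ∀ s, ∑ j, (if φ j x = s then (α j x : ℝ) ^ 2 else 0) = S := fun s => by
    rw [← h x s]
    push_cast
    rfl
  calc ∑ j, (u (Fin.cons (φ j x) x) * α j x) ^ 2
      = ∑ j, ∑ s, u (Fin.cons s x) ^ 2 * (if φ j x = s then (α j x : ℝ) ^ 2 else 0) := by
        refine Finset.sum_congr rfl fun j _ => ?_
        simp [mul_pow]
    _ = ∑ s, u (Fin.cons s x) ^ 2 * ∑ j, (if φ j x = s then (α j x : ℝ) ^ 2 else 0) := by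
        rw [Finset.sum_comm]
        simp only [Finset.mul_sum]
    _ = S * ∑ s, u (Fin.cons s x) ^ 2 := by
        simp only [h', Finset.mul_sum]
        exact Finset.sum_congr rfl fun s _ => mul_comm _ _

/-- A weighted bilinear bound on the exponential moment of the number of games won. -/
lemma two_mul_sum_pow_winCount_le (n : ℕ) : ∀ (f g : (Fin n → Bool) → (Fin n → Bool))
    (u v : (Fin n → Bool) → ℝ), (∀ x, 0 ≤ u x) → (∀ y, 0 ≤ v y) →
    2 * ∑ x, ∑ y, u x * v y * (3 / 2 : ℝ) ^ winCount n (f x) (g y) x y ≤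
      (111 / 40) ^ n * (∑ x, u x ^ 2 + ∑ y, v y ^ 2) := by
  induction n with
  | zero =>
    intro f g u v _ _
    simp only [Fintype.sum_unique, winCount, Finset.univ_eq_empty, Finset.filter_empty,
      Finset.card_empty, pow_zero]
    rw [mul_one, one_mul, ← mul_assoc]
    exact two_mul_le_add_sq _ _
  | succ n ih =>
    intro f g u v hu hv
    let A : (Fin n → Bool) → Bool → Bool := fun x s => f (Fin.cons s x) 0
    let B : (Fin n → Bool) → Bool → Bool := fun y t => g (Fin.cons t y) 0
    let K : (Fin n → Bool) → (Fin n → Bool) → Bool → Bool → ℝ := fun x y s t =>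
      u (Fin.cons s x) * v (Fin.cons t y) *
        (3 / 2 : ℝ) ^ winCount n (Fin.tail (f (Fin.cons s x))) (Fin.tail (g (Fin.cons t y))) x y
    have hK : ∀ x y s t, 0 ≤ K x y s t := fun x y s t =>
      mul_nonneg (mul_nonneg (hu _) (hv _)) (by positivity)
    have hpoint : ∀ x y, ∑ s, ∑ t, K x y s t *
        (40 * 4233 * (if xor (A x s) (B y t) = (s && t) then 3 else 2)) ≤
        ∑ j, K x y (aliceBit j (A x)) (bobBit j (B y)) *
          (111 * 2 * (aliceAmp j (A x) * bobAmp j (B y))) := fun x y => by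
      refine sum_mul_le_sum_of_cover (K x y) _ (hK x y) _ _ _ fun s t => ?_
      have := le_sum_aliceAmp_mul_bobAmp (A x) (B y) s t
      have h : (40 * 4233 * (if xor (A x s) (B y t) = (s && t) then 3 else 2) : ℝ) ≤
        111 * 2 * ∑ j, (if aliceBit j (A x) = s ∧ bobBit j (B y) = t then
          (aliceAmp j (A x) * bobAmp j (B y) : ℝ) else 0) := by exact_mod_cast this
      simpa only [Finset.mul_sum, mul_ite, mul_zero] using h
    have hlhs : ∑ x, ∑ y, u x * v y * (3 / 2 : ℝ) ^ winCount (n + 1) (f x) (g y) x y =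
        ∑ x, ∑ y, ∑ s, ∑ t, K x y s t *
          (if xor (A x s) (B y t) = (s && t) then 3 else 2) / 2 := by
      rw [sum_fin_succ_bool]
      refine Finset.sum_congr rfl fun x _ => ?_
      simp only [sum_fin_succ_bool (n := n)]
      rw [Finset.sum_comm]
      refine Finset.sum_congr rfl fun y _ => Finset.sum_congr rfl fun s _ =>
        Finset.sum_congr rfl fun t _ => ?_
      rw [winCount_cons, pow_add]
      simp only [K, A, B]
      split_ifs <;> ring
    have hrule : ∀ j : Bool × Fin 8,
        2 * ∑ x, ∑ y, K x y (aliceBit j (A x)) (bobBit j (B y)) *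
          (aliceAmp j (A x) * bobAmp j (B y)) ≤
        (111 / 40) ^ n *
          (∑ x, (u (Fin.cons (aliceBit j (A x)) x) * aliceAmp j (A x)) ^ 2 +
            ∑ y, (v (Fin.cons (bobBit j (B y)) y) * bobAmp j (B y)) ^ 2) := fun j => by
      refine le_trans (le_of_eq ?_) (ih (fun x => Fin.tail (f (Fin.cons (aliceBit j (A x)) x)))
        (fun y => Fin.tail (g (Fin.cons (bobBit j (B y)) y))) _ _
        (fun x => mul_nonneg (hu _) (Nat.cast_nonneg _))
        (fun y => mul_nonneg (hv _) (Nat.cast_nonneg _)))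
      congr 1
      refine Finset.sum_congr rfl fun x _ => Finset.sum_congr rfl fun y _ => ?_
      simp only [K]
      ring
    have hsum := Finset.sum_le_sum fun j (_ : j ∈ Finset.univ) => hrule j
    rw [← Finset.mul_sum, ← Finset.mul_sum, Finset.sum_add_distrib,
      sum_sum_sq_select u (fun j x => aliceBit j (A x)) (fun j x => aliceAmp j (A x)) 4233
        (fun x s => sum_aliceAmp_sq (A x) s),
      sum_sum_sq_select v (fun j y => bobBit j (B y)) (fun j y => bobAmp j (B y)) 4233
        (fun y t => sum_bobAmp_sq (B y) t)] at hsum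
    have hcover := Finset.sum_le_sum fun x (_ : x ∈ Finset.univ) =>
      Finset.sum_le_sum fun y (_ : y ∈ Finset.univ) => hpoint x y
    have hl : ∑ x, ∑ y, ∑ s, ∑ t, K x y s t *
        (40 * 4233 * (if xor (A x s) (B y t) = (s && t) then 3 else 2)) =
        2 * 40 * 4233 * ∑ x, ∑ y, u x * v y * (3 / 2 : ℝ) ^ winCount (n + 1) (f x) (g y) x y := by
      rw [hlhs]
      simp only [Finset.mul_sum]
      refine Finset.sum_congr rfl fun x _ => Finset.sum_congr rfl fun y _ =>
        Finset.sum_congr rfl fun s _ => Finset.sum_congr rfl fun t _ => by ring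
    have hr : ∑ x, ∑ y, ∑ j, K x y (aliceBit j (A x)) (bobBit j (B y)) *
          (111 * 2 * (aliceAmp j (A x) * bobAmp j (B y))) =
        111 * 2 * ∑ j, ∑ x, ∑ y, K x y (aliceBit j (A x)) (bobBit j (B y)) *
          (aliceAmp j (A x) * bobAmp j (B y)) := by
      simp only [Finset.mul_sum]
      rw [Finset.sum_comm (s := (Finset.univ : Finset (Bool × Fin 8)))]
      refine Finset.sum_congr rfl fun x _ => ?_
      rw [Finset.sum_comm]
      refine Finset.sum_congr rfl fun j _ => Finset.sum_congr rfl fun y _ => by ring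
    rw [hl, hr] at hcover
    rw [pow_succ]
    push_cast at hsum
    linarith

lemma sum_pow_winCount_le (n : ℕ) (f g : (Fin n → Bool) → (Fin n → Bool)) :
    ∑ x, ∑ y, (3 / 2 : ℝ) ^ winCount n (f x) (g y) x y ≤ (111 / 40) ^ n * 2 ^ n := by
  have h := two_mul_sum_pow_winCount_le n f g (fun _ => 1) (fun _ => 1)
    (fun _ => zero_le_one) (fun _ => zero_le_one)
  simp only [one_mul, mul_one, one_pow, Finset.sum_const, Finset.card_univ, Fintype.card_fun,
    Fintype.card_bool, Fintype.card_fin, nsmul_eq_mul, Nat.cast_pow, Nat.cast_ofNat] at h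
  linarith

lemma prUniform_le_of_sum_pow_le {n : ℕ} (N : (Fin n → Bool) → (Fin n → Bool) → ℕ)
    {b c M : ℝ} (hb : 1 ≤ b) (hM : ∑ x, ∑ y, b ^ N x y ≤ M) :
    prUniform n (fun x y => c ≤ (N x y : ℝ)) ≤ M / b ^ c / (2 ^ n * 2 ^ n) := by
  have hb0 : 0 < b := by linarith
  unfold prUniform
  refine div_le_div_of_nonneg_right ?_ (by positivity)
  rw [le_div_iff₀ (Real.rpow_pos_of_pos hb0 c), ← nsmul_eq_mul]
  refine le_trans (Finset.card_nsmul_le_sum _ (fun p => b ^ N p.1 p.2) _ fun p hp => ?_)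
    (le_trans (Finset.sum_le_univ_sum_of_nonneg fun p => by positivity)
      (le_trans (le_of_eq (Fintype.sum_prod_type _)) hM))
  rw [← Real.rpow_natCast]
  exact Real.rpow_le_rpow_of_exponent_le hb (Finset.mem_filter.1 hp).2

lemma le_golden_ratio_half : (38 / 47 : ℝ) ≤ (1 + Real.sqrt 5) / 4 := by
  have : (2.236 : ℝ) ≤ Real.sqrt 5 := Real.le_sqrt_of_sq_le (by norm_num)
  linarith

lemma two_fifths_le_log : (2 / 5 : ℝ) ≤ Real.log (3 / 2) := by
  rw [Real.le_log_iff_exp_le (by norm_num)]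
  have h : Real.exp (2 / 5) ^ 5 ≤ (3 / 2 : ℝ) ^ 5 := by
    rw [← Real.exp_nat_mul]
    have := Real.exp_one_lt_d9
    have h2 : Real.exp ((5 : ℕ) * (2 / 5)) = Real.exp 1 ^ 2 := by
      rw [← Real.exp_nat_mul]
      norm_num
    rw [h2]
    nlinarith [Real.exp_pos 1]
  exact le_of_pow_le_pow_left₀ (by norm_num) (by norm_num) h

lemma moment_le_rpow : (111 / 80 : ℝ) ≤ (3 / 2) ^ ((1 + Real.sqrt 5) / 4) := by
  have h : (111 / 80 : ℝ) ≤ (3 / 2) ^ (38 / 47 : ℝ) := by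
    refine le_of_pow_le_pow_left₀ (n := 47) (by norm_num) (by positivity) ?_
    rw [← Real.rpow_mul_natCast (by norm_num)]
    norm_num
  exact h.trans (Real.rpow_le_rpow_of_exponent_le (by norm_num) le_golden_ratio_half)

/-- Lemma 3.1: any deterministic classical strategy `(f, g)` for `n` parallel CHSH games
wins at least `((1+√5)/4 + ε)·n` copies with probability at most `exp(−2ε²n)`. -/
theorem chsh_threshold_classical_bound (n : ℕ) (hn : 1 ≤ n) (ε : ℝ) (hε : 0 < ε)
    (f g : (Fin n → Bool) → (Fin n → Bool)) :
    prUniform n (fun x y =>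
        ((1 + Real.sqrt 5) / 4 + ε) * n ≤ (winCount n (f x) (g y) x y : ℝ)) ≤
      Real.exp (-2 * ε ^ 2 * n) := by
  have hn0 : (0 : ℝ) < n := by exact_mod_cast hn
  rcases le_or_gt ε (1 / 5) with hε5 | hε5
  · refine (prUniform_le_of_sum_pow_le _ (by norm_num) (sum_pow_winCount_le n f g)).trans ?_
    set p := (1 + Real.sqrt 5) / 4
    have hsplit : (3 / 2 : ℝ) ^ ((p + ε) * n) =
        ((3 / 2) ^ p) ^ n * Real.exp (Real.log (3 / 2) * (ε * n)) := by
      rw [add_mul, Real.rpow_add (by norm_num), Real.rpow_mul_natCast (by norm_num),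
        Real.rpow_def_of_pos (by norm_num : (0 : ℝ) < 3 / 2) (ε * n)]
    have hpow : (111 / 40 : ℝ) ^ n * 2 ^ n ≤ ((3 / 2) ^ p) ^ n * (2 ^ n * 2 ^ n) := by
      have := pow_le_pow_left₀ (by norm_num) moment_le_rpow n
      calc (111 / 40 : ℝ) ^ n * 2 ^ n = (111 / 80) ^ n * (2 ^ n * 2 ^ n) := by
            simp only [← mul_pow]
            norm_num
        _ ≤ _ := by gcongr
    have hexp : 1 ≤ Real.exp (-2 * ε ^ 2 * n) * Real.exp (Real.log (3 / 2) * (ε * n)) := by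
      rw [← Real.exp_add, Real.one_le_exp_iff]
      have : 0 ≤ (ε * n) * (Real.log (3 / 2) - 2 * ε) :=
        mul_nonneg (by positivity) (by linarith [two_fifths_le_log])
      linarith
    have hP : (0 : ℝ) ≤ ((3 / 2) ^ p) ^ n * (2 ^ n * 2 ^ n) := by positivity
    rw [div_div, div_le_iff₀ (by positivity), hsplit]
    nlinarith [mul_le_mul_of_nonneg_left hexp hP]
  · have hempty : prUniform n (fun x y =>
        ((1 + Real.sqrt 5) / 4 + ε) * n ≤ (winCount n (f x) (g y) x y : ℝ)) = 0 := by
      unfold prUniform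
      rw [Finset.filter_false_of_mem, Finset.card_empty, Nat.cast_zero, zero_div]
      rintro ⟨x, y⟩ -
      have hle : winCount n (f x) (g y) x y ≤ n := by
        simpa [winCount] using Finset.card_filter_le (Finset.univ : Finset (Fin n))
          (fun i => xor (f x i) (g y i) = (x i && y i))
      have hle' : (winCount n (f x) (g y) x y : ℝ) ≤ n := by exact_mod_cast hle
      have := le_golden_ratio_half
      rw [not_le]
      nlinarith
    rw [hempty]
    exact (Real.exp_pos _).le
end

section
/- Let α ∈ [0,1], and suppose that for every m ≥ 1 and all functions f, g : {0,1}^m → {0,1}^m, the probability over independent uniform x, y ∈ {0,1}^m that f(x)_i XOR g(y)_i = x_i AND y_i holds for all i ∈ [m] is at most α^m. Then for every n ≥ 1, all functions f, g : {0,1}^n → {0,1}^n, and every subset S ⊆ [n], the probability over independent uniform x, y ∈ {0,1}^n that f(x)_i XOR g(y)_i = x_i AND y_i holds for all i ∈ S is at most α^{|S|}. -/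
open scoped Classical

/-- A bound on the probability of an event that holds after fixing any auxiliary coordinates of
both inputs holds for the event itself. -/
theorem prUniform_le_of_forall_fiber {n m : ℕ} {U : Type*} [Fintype U]
    (e : (Fin m → Bool) × U ≃ (Fin n → Bool)) (P : (Fin n → Bool) → (Fin n → Bool) → Prop)
    (c : ℝ) (h : ∀ u v, prUniform m (fun a b => P (e (a, u)) (e (b, v))) ≤ c) :
    prUniform n P ≤ c := by
  have hcard : (2 : ℝ) ^ n = 2 ^ m * Fintype.card U := by
    have := Fintype.card_congr e
    simp only [Fintype.card_prod, Fintype.card_fun, Fintype.card_bool, Fintype.card_fin] at this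
    exact_mod_cast this.symm
  have hcount : ((Finset.univ.filter (fun p : (Fin n → Bool) × (Fin n → Bool) =>
      P p.1 p.2)).card : ℝ) = ∑ w : U × U, ((Finset.univ.filter
        (fun p : (Fin m → Bool) × (Fin m → Bool) =>
          P (e (p.1, w.1)) (e (p.2, w.2)))).card : ℝ) := by
    simp only [Finset.card_filter, Nat.cast_sum]
    rw [← (Equiv.prodCongr e e).sum_comp, ← (Equiv.prodProdProdComm _ _ _ _).sum_comp,
      Fintype.sum_prod_type_right]
    rfl
  have hfiber : ∀ w : U × U, ((Finset.univ.filter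
      (fun p : (Fin m → Bool) × (Fin m → Bool) =>
        P (e (p.1, w.1)) (e (p.2, w.2)))).card : ℝ) ≤ c * (2 ^ m * 2 ^ m) := fun w =>
    (div_le_iff₀ (by positivity)).1 (h w.1 w.2)
  unfold prUniform
  rw [div_le_iff₀ (by positivity), hcount]
  refine (Finset.sum_le_sum fun w _ => hfiber w).trans_eq ?_
  rw [Finset.sum_const, Finset.card_univ, Fintype.card_prod, nsmul_eq_mul, hcard]
  push_cast
  ring

/-- Split a bit string into its bits indexed by `S`, enumerated by `Fin S.card`, and the rest. -/
noncomputable def bitsSplitEquiv {n : ℕ} (S : Finset (Fin n)) :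
    (Fin S.card → Bool) × ({i // i ∉ S} → Bool) ≃ (Fin n → Bool) :=
  ((Equiv.arrowCongr S.equivFin.symm (Equiv.refl Bool)).prodCongr (Equiv.refl _)).trans
    (Equiv.piEquivPiSubtypeProd (fun i => i ∈ S) (fun _ => Bool)).symm

theorem bitsSplitEquiv_apply_equivFin_symm {n : ℕ} (S : Finset (Fin n)) (a : Fin S.card → Bool)
    (u : {i // i ∉ S} → Bool) (j : Fin S.card) :
    bitsSplitEquiv S (a, u) (S.equivFin.symm j) = a j := by
  simp [bitsSplitEquiv, Equiv.piEquivPiSubtypeProd]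

/-- The embedding claim inside Lemma 3.1: if the all-copies classical value of `m` parallel
CHSH games is at most `α^m` for every `m ≥ 1`, then for any strategy on `n` copies, the
probability of winning all copies in any fixed subset `S ⊆ [n]` is at most `α^|S|`. -/
theorem chsh_subset_win_bound (α : ℝ) (hα0 : 0 ≤ α) (hα1 : α ≤ 1)
    (h : ∀ m : ℕ, 1 ≤ m → ∀ f g : (Fin m → Bool) → (Fin m → Bool),
      prUniform m (fun x y => ∀ i : Fin m, Bool.xor (f x i) (g y i) = (x i && y i)) ≤ α ^ m) :
    ∀ n : ℕ, 1 ≤ n → ∀ f g : (Fin n → Bool) → (Fin n → Bool), ∀ S : Finset (Fin n),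
      prUniform n (fun x y => ∀ i ∈ S, Bool.xor (f x i) (g y i) = (x i && y i)) ≤
        α ^ S.card := by
  intro n _ f g S
  rcases S.eq_empty_or_nonempty with rfl | hS
  · simp [prUniform]
  · refine prUniform_le_of_forall_fiber (bitsSplitEquiv S) _ _ fun u v => ?_
    convert h S.card hS.card_pos
      (fun a j => f (bitsSplitEquiv S (a, u)) (S.equivFin.symm j))
      (fun b j => g (bitsSplitEquiv S (b, v)) (S.equivFin.symm j)) using 4 with a b
    constructor
    · intro hwin j
      simpa only [bitsSplitEquiv_apply_equivFin_symm] using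
        hwin (S.equivFin.symm j) (S.equivFin.symm j).2
    · intro hwin i hi
      obtain ⟨j, hj⟩ := S.equivFin.symm.surjective ⟨i, hi⟩
      obtain rfl : (S.equivFin.symm j : Fin n) = i := congrArg Subtype.val hj
      simpa only [bitsSplitEquiv_apply_equivFin_symm] using hwin j
end

section
/- Let n ≥ 1, ε > 0, K ≥ 1, and let R be a finite set equipped with a probability distribution ρ (shared randomness). Let a : R × {0,1}^n → {0,1}^n be Alice's output function, m : R × {0,1}^n → Fin K be Alice's message function, and b : R × Fin K × {0,1}^n → {0,1}^n be Bob's output function. Then the probability, over r ~ ρ and independent uniform x, y ∈ {0,1}^n, that |{i ∈ [n] : a(r,x)_i XOR b(r, m(r,x), y)_i = x_i AND y_i}| ≥ ((1+√5)/4 + ε)·n is at most K · exp(−2ε²n). -/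
open scoped Classical

/-- The payoff of one CHSH copy with outputs `a, b` and inputs `x, y`: `1` if won, `q` if not. -/
noncomputable def copyWeight (q : ℝ) (a b x y : Bool) : ℝ :=
  if Bool.xor a b = (x && y) then 1 else q

/-- The product of the payoffs of all copies. -/
noncomputable def strategyWeight (q : ℝ) {n : ℕ} (a b x y : Fin n → Bool) : ℝ :=
  ∏ i, copyWeight q (a i) (b i) (x i) (y i)

/-- A weighted family of rules by which each player, knowing the own answers `a₀, a₁` to the two
possible inputs of one CHSH copy, selects one of these inputs and attaches an amplitude to it,
such that the payoff matrix of the copy is dominated by the average of the selected pairs. -/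
structure SelectionScheme (Ω : Type) [Fintype Ω] (q κ : ℝ) where
  weight : Ω → ℝ
  selA : Ω → Bool → Bool → Bool
  selB : Ω → Bool → Bool → Bool
  ampA : Ω → Bool → Bool → ℝ
  ampB : Ω → Bool → Bool → ℝ
  weight_nonneg : ∀ ω, 0 ≤ weight ω
  ampA_nonneg : ∀ ω a₀ a₁, 0 ≤ ampA ω a₀ a₁
  ampB_nonneg : ∀ ω b₀ b₁, 0 ≤ ampB ω b₀ b₁
  copyWeight_le : ∀ a₀ a₁ b₀ b₁ x y, copyWeight q (cond x a₁ a₀) (cond y b₁ b₀) x y ≤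
    ∑ ω, if selA ω a₀ a₁ = x ∧ selB ω b₀ b₁ = y then
      weight ω * (ampA ω a₀ a₁ * ampB ω b₀ b₁) else 0
  sum_ampA_le : ∀ a₀ a₁ x,
    ∑ ω, (if selA ω a₀ a₁ = x then weight ω * ampA ω a₀ a₁ ^ 2 else 0) ≤ κ
  sum_ampB_le : ∀ b₀ b₁ y,
    ∑ ω, (if selB ω b₀ b₁ = y then weight ω * ampB ω b₀ b₁ ^ 2 else 0) ≤ κ

lemma strategyWeight_nonneg {q : ℝ} (hq : 0 ≤ q) {n : ℕ} (a b x y : Fin n → Bool) :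
    0 ≤ strategyWeight q a b x y := by
  refine Finset.prod_nonneg fun i _ => ?_
  unfold copyWeight
  split_ifs <;> simp [hq]

lemma strategyWeight_succ (q : ℝ) {n : ℕ} (a b : Fin (n + 1) → Bool) (x₀ y₀ : Bool)
    (x y : Fin n → Bool) :
    strategyWeight q a b (Fin.cons x₀ x : Fin (n + 1) → Bool) (Fin.cons y₀ y : Fin (n + 1) → Bool) =
      copyWeight q (a 0) (b 0) x₀ y₀ * strategyWeight q (Fin.tail a) (Fin.tail b) x y := by
  simp [strategyWeight, Fin.prod_univ_succ, Fin.tail]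

lemma sum_boolVec_succ {n : ℕ} (F : (Fin (n + 1) → Bool) → ℝ) :
    ∑ x, F x = ∑ x : Fin n → Bool, ∑ x₀ : Bool, F (Fin.cons x₀ x : Fin (n + 1) → Bool) := by
  rw [Finset.sum_comm, ← Fintype.sum_prod_type',
    ← (Fin.consEquiv fun _ : Fin (n + 1) => Bool).sum_comp]
  rfl

lemma sum_selected {Ω : Type} [Fintype Ω] (w : Ω → ℝ) (s : Ω → Bool) (F : Bool → ℝ) :
    ∑ ω, w ω * F (s ω) = ∑ x, F x * ∑ ω, (if s ω = x then w ω else 0) := by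
  simp_rw [Finset.mul_sum]
  rw [Finset.sum_comm]
  refine Finset.sum_congr rfl fun ω _ => ?_
  simp [mul_comm]

lemma sum_selected_sq_le {Ω : Type} [Fintype Ω] {κ : ℝ} {n : ℕ} (w : Ω → ℝ)
    (s : Ω → (Fin n → Bool) → Bool) (u : Ω → (Fin n → Bool) → ℝ)
    (h : ∀ x x₀, ∑ ω, (if s ω x = x₀ then w ω * u ω x ^ 2 else 0) ≤ κ)
    (f : (Fin (n + 1) → Bool) → ℝ) :
    ∑ ω, w ω * ∑ x, (u ω x * f (Fin.cons (s ω x) x : Fin (n + 1) → Bool)) ^ 2 ≤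
      κ * ∑ x, f x ^ 2 := by
  rw [sum_boolVec_succ]
  simp_rw [Finset.mul_sum]
  rw [Finset.sum_comm]
  refine Finset.sum_le_sum fun x _ => ?_
  calc ∑ ω, w ω * (u ω x * f (Fin.cons (s ω x) x : Fin (n + 1) → Bool)) ^ 2
      = ∑ ω, (w ω * u ω x ^ 2) * f (Fin.cons (s ω x) x : Fin (n + 1) → Bool) ^ 2 :=
        Finset.sum_congr rfl fun ω _ => by ring
    _ = _ := sum_selected (fun ω => w ω * u ω x ^ 2) (fun ω => s ω x)
        (fun x₀ => f (Fin.cons x₀ x : Fin (n + 1) → Bool) ^ 2)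
    _ ≤ ∑ x₀, κ * f (Fin.cons x₀ x : Fin (n + 1) → Bool) ^ 2 :=
        Finset.sum_le_sum fun x₀ _ => by
          rw [mul_comm]
          exact mul_le_mul_of_nonneg_right (h x x₀) (sq_nonneg _)

lemma sum_sum_selected {Ω : Type} [Fintype Ω] (w : Ω → ℝ) (s t : Ω → Bool)
    (F : Bool → Bool → ℝ) :
    ∑ ω, w ω * F (s ω) (t ω) =
      ∑ x, ∑ y, F x y * ∑ ω, (if s ω = x ∧ t ω = y then w ω else 0) := by
  simp_rw [Finset.mul_sum]
  rw [Finset.sum_congr rfl fun x _ => Finset.sum_comm, Finset.sum_comm]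
  refine Finset.sum_congr rfl fun ω _ => ?_
  simp only [Fintype.sum_bool]
  cases s ω <;> cases t ω <;> simp [mul_comm]

/-- A selection scheme for one copy bounds the expected payoff of `n` copies played in parallel. -/
theorem SelectionScheme.sum_strategyWeight_le {Ω : Type} [Fintype Ω] {q κ : ℝ} (hq : 0 ≤ q)
    (hκ : 0 ≤ κ) (S : SelectionScheme Ω q κ) (n : ℕ) (a b : (Fin n → Bool) → (Fin n → Bool))
    (f g : (Fin n → Bool) → ℝ) (hf : ∀ x, 0 ≤ f x) (hg : ∀ y, 0 ≤ g y) :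
    2 * ∑ x, ∑ y, f x * g y * strategyWeight q (a x) (b y) x y ≤
      κ ^ n * (∑ x, f x ^ 2 + ∑ y, g y ^ 2) := by
  induction n with
  | zero =>
    have hsum (h : (Fin 0 → Bool) → ℝ) : ∑ x, h x = h default :=
      Fintype.sum_subsingleton h default
    simp only [hsum, strategyWeight, Finset.univ_eq_empty, Finset.prod_empty, pow_zero]
    linarith [two_mul_le_add_sq (f default) (g default)]
  | succ n ih =>
    let cx (x₀ : Bool) (x : Fin n → Bool) : Fin (n + 1) → Bool := Fin.cons x₀ x
    let s (ω : Ω) (x : Fin n → Bool) := S.selA ω (a (cx false x) 0) (a (cx true x) 0)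
    let t (ω : Ω) (y : Fin n → Bool) := S.selB ω (b (cx false y) 0) (b (cx true y) 0)
    let u (ω : Ω) (x : Fin n → Bool) := S.ampA ω (a (cx false x) 0) (a (cx true x) 0)
    let v (ω : Ω) (y : Fin n → Bool) := S.ampB ω (b (cx false y) 0) (b (cx true y) 0)
    let rest (x₀ y₀ : Bool) (x y : Fin n → Bool) : ℝ :=
      strategyWeight q (Fin.tail (a (cx x₀ x))) (Fin.tail (b (cx y₀ y))) x y
    have key (x y : Fin n → Bool) :
        ∑ x₀, ∑ y₀, f (cx x₀ x) * g (cx y₀ y) *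
          strategyWeight q (a (cx x₀ x)) (b (cx y₀ y)) (cx x₀ x) (cx y₀ y) ≤
        ∑ ω, S.weight ω * ((u ω x * f (cx (s ω x) x)) * (v ω y * g (cx (t ω y) y)) *
          rest (s ω x) (t ω y) x y) := by
      calc _ ≤ ∑ x₀, ∑ y₀, (f (cx x₀ x) * g (cx y₀ y) * rest x₀ y₀ x y) *
              ∑ ω, (if s ω x = x₀ ∧ t ω y = y₀ then S.weight ω * (u ω x * v ω y) else 0) := by
            refine Finset.sum_le_sum fun x₀ _ => Finset.sum_le_sum fun y₀ _ => ?_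
            have hle := S.copyWeight_le (a (cx false x) 0) (a (cx true x) 0)
              (b (cx false y) 0) (b (cx true y) 0) x₀ y₀
            have ha : cond x₀ (a (cx true x) 0) (a (cx false x) 0) = a (cx x₀ x) 0 := by
              cases x₀ <;> rfl
            have hb : cond y₀ (b (cx true y) 0) (b (cx false y) 0) = b (cx y₀ y) 0 := by
              cases y₀ <;> rfl
            rw [ha, hb] at hle
            rw [strategyWeight_succ, mul_comm (copyWeight _ _ _ _ _), ← mul_assoc]
            exact mul_le_mul_of_nonneg_left hle
              (mul_nonneg (mul_nonneg (hf _) (hg _)) (strategyWeight_nonneg hq _ _ _ _))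
        _ = ∑ ω, (S.weight ω * (u ω x * v ω y)) *
              (f (cx (s ω x) x) * g (cx (t ω y) y) * rest (s ω x) (t ω y) x y) :=
            (sum_sum_selected (fun ω => S.weight ω * (u ω x * v ω y)) (fun ω => s ω x)
              (fun ω => t ω y) fun x₀ y₀ => f (cx x₀ x) * g (cx y₀ y) * rest x₀ y₀ x y).symm
        _ = _ := Finset.sum_congr rfl fun ω _ => by ring
    have hA := sum_selected_sq_le S.weight s u (fun x x₀ => S.sum_ampA_le _ _ x₀) f
    have hB := sum_selected_sq_le S.weight t v (fun y y₀ => S.sum_ampB_le _ _ y₀) g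
    calc 2 * ∑ x, ∑ y, f x * g y * strategyWeight q (a x) (b y) x y
        = 2 * ∑ x, ∑ y, ∑ x₀, ∑ y₀, f (cx x₀ x) * g (cx y₀ y) *
            strategyWeight q (a (cx x₀ x)) (b (cx y₀ y)) (cx x₀ x) (cx y₀ y) := by
          rw [sum_boolVec_succ]
          simp_rw [sum_boolVec_succ (n := n) (fun y => _ * g y * _)]
          congr 1
          exact Finset.sum_congr rfl fun x _ => Finset.sum_comm
      _ ≤ 2 * ∑ x, ∑ y, ∑ ω, S.weight ω * ((u ω x * f (cx (s ω x) x)) *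
            (v ω y * g (cx (t ω y) y)) * rest (s ω x) (t ω y) x y) := by
          gcongr with x _ y _
          exact key x y
      _ = ∑ ω, S.weight ω * (2 * ∑ x, ∑ y, (u ω x * f (cx (s ω x) x)) *
            (v ω y * g (cx (t ω y) y)) * rest (s ω x) (t ω y) x y) := by
          simp_rw [Finset.mul_sum]
          rw [Finset.sum_congr rfl fun x _ => Finset.sum_comm, Finset.sum_comm]
          refine Finset.sum_congr rfl fun ω _ => Finset.sum_congr rfl fun x _ =>
            Finset.sum_congr rfl fun y _ => by ring
      _ ≤ ∑ ω, S.weight ω * (κ ^ n * (∑ x, (u ω x * f (cx (s ω x) x)) ^ 2 +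
            ∑ y, (v ω y * g (cx (t ω y) y)) ^ 2)) :=
          Finset.sum_le_sum fun ω _ => mul_le_mul_of_nonneg_left
            (ih (fun x => Fin.tail (a (cx (s ω x) x))) (fun y => Fin.tail (b (cx (t ω y) y)))
              (fun x => u ω x * f (cx (s ω x) x)) (fun y => v ω y * g (cx (t ω y) y))
              (fun x => mul_nonneg (S.ampA_nonneg _ _ _) (hf _))
              (fun y => mul_nonneg (S.ampB_nonneg _ _ _) (hg _))) (S.weight_nonneg ω)
      _ = κ ^ n * (∑ ω, S.weight ω * ∑ x, (u ω x * f (cx (s ω x) x)) ^ 2 +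
            ∑ ω, S.weight ω * ∑ y, (v ω y * g (cx (t ω y) y)) ^ 2) := by
          rw [← Finset.sum_add_distrib, Finset.mul_sum]
          exact Finset.sum_congr rfl fun ω _ => by ring
      _ ≤ κ ^ n * (κ * ∑ x, f x ^ 2 + κ * ∑ y, g y ^ 2) :=
          mul_le_mul_of_nonneg_left (add_le_add hA hB) (pow_nonneg hκ n)
      _ = _ := by ring

/-! ### An explicit selection scheme

The four pairs (input, answer) of Alice and the four of Bob form an octagon in which two pairs are
adjacent when they win. A player's answers to both inputs are two vertices at distance two; they
are encoded by the vertex between them. The scheme uses the rotations of three labellings of the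
octagon, the label at that vertex telling on which side of it the selected pair lies. -/

/-- The octagon vertex encoding Alice's answers. -/
def vertexA : Bool → Bool → ℕ
  | false, false => 1
  | true, false => 3
  | true, true => 5
  | false, true => 7

/-- The octagon vertex encoding Bob's answers. -/
def vertexB : Bool → Bool → ℕ
  | false, false => 0
  | false, true => 2
  | true, true => 4
  | true, false => 6

/-- The labellings with alternating runs of length `4`, `2` and `1`. -/
def octagonLabel (k : Fin 3) (p : ℕ) : Bool :=
  match k with
  | 0 => decide (p % 8 < 4)
  | 1 => decide (p % 4 < 2)
  | 2 => decide (p % 2 < 1)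

/-- The amplitudes `343 * (6 / 7) ^ j`, where `j` is the distance to the nearest boundary at which
the label turns from `true` to `false`. -/
def octagonAmp (k : Fin 3) (p : ℕ) : ℕ :=
  match k with
  | 0 => match p % 8 with
    | 0 | 7 => 216
    | 1 | 6 => 252
    | 2 | 5 => 294
    | _ => 343
  | 1 => match p % 4 with
    | 0 | 3 => 294
    | _ => 343
  | 2 => 343

/-- The weights of the three labellings. -/
def octagonWeight : Fin 3 → ℕ
  | 0 => 57624
  | 1 => 102538
  | 2 => 6355

/-- The neighbour of the vertex `c` chosen by the labelling `ω`. -/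
def octagonSel (ω : Fin 3 × Fin 8) (c : ℕ) : ℕ :=
  if octagonLabel ω.1 (c + ω.2) then c + 1 else c + 7

lemma octagon_copyWeight_le : ∀ a₀ a₁ b₀ b₁ x y : Bool,
    (if Bool.xor (cond x a₁ a₀) (cond y b₁ b₀) = (x && y) then 42 else 29) *
      (288120 * 343 ^ 2) ≤
    42 * ∑ ω : Fin 3 × Fin 8, if decide (octagonSel ω (vertexA a₀ a₁) % 4 = 2) = x ∧
        decide (octagonSel ω (vertexB b₀ b₁) % 4 = 3) = y then
      octagonWeight ω.1 * (octagonAmp ω.1 (vertexA a₀ a₁ + ω.2) *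
        octagonAmp ω.1 (vertexB b₀ b₁ + ω.2)) else 0 := by
  decide +kernel

lemma octagon_sum_ampA_le : ∀ a₀ a₁ x : Bool,
    7 * ∑ ω : Fin 3 × Fin 8, (if decide (octagonSel ω (vertexA a₀ a₁) % 4 = 2) = x then
      octagonWeight ω.1 * octagonAmp ω.1 (vertexA a₀ a₁ + ω.2) ^ 2 else 0) ≤
    13 * (288120 * 343 ^ 2) := by
  decide +kernel

lemma octagon_sum_ampB_le : ∀ b₀ b₁ y : Bool,
    7 * ∑ ω : Fin 3 × Fin 8, (if decide (octagonSel ω (vertexB b₀ b₁) % 4 = 3) = y then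
      octagonWeight ω.1 * octagonAmp ω.1 (vertexB b₀ b₁ + ω.2) ^ 2 else 0) ≤
    13 * (288120 * 343 ^ 2) := by
  decide +kernel

lemma sum_ite_div_mul {Ω : Type} [Fintype Ω] (P : Ω → Prop) [DecidablePred P] (w t : Ω → ℝ)
    (d : ℝ) : ∑ ω, (if P ω then w ω / d * t ω else 0) =
      (∑ ω, if P ω then w ω * t ω else 0) / d := by
  rw [Finset.sum_div]
  refine Finset.sum_congr rfl fun ω _ => ?_
  split_ifs <;> ring

/-- The selection scheme given by the three labellings of the octagon. -/
noncomputable def octagonScheme : SelectionScheme (Fin 3 × Fin 8) (29 / 42) (13 / 7) where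
  weight ω := octagonWeight ω.1 / (288120 * 343 ^ 2)
  selA ω a₀ a₁ := decide (octagonSel ω (vertexA a₀ a₁) % 4 = 2)
  selB ω b₀ b₁ := decide (octagonSel ω (vertexB b₀ b₁) % 4 = 3)
  ampA ω a₀ a₁ := octagonAmp ω.1 (vertexA a₀ a₁ + ω.2)
  ampB ω b₀ b₁ := octagonAmp ω.1 (vertexB b₀ b₁ + ω.2)
  weight_nonneg ω := by positivity
  ampA_nonneg ω _ _ := by positivity
  ampB_nonneg ω _ _ := by positivity
  copyWeight_le a₀ a₁ b₀ b₁ x y := by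
    have h := (Nat.cast_le (α := ℝ)).2 (octagon_copyWeight_le a₀ a₁ b₀ b₁ x y)
    rw [sum_ite_div_mul, le_div_iff₀ (by norm_num)]
    unfold copyWeight
    push_cast at h
    split_ifs at h ⊢ <;> linarith
  sum_ampA_le a₀ a₁ x := by
    have h := (Nat.cast_le (α := ℝ)).2 (octagon_sum_ampA_le a₀ a₁ x)
    rw [sum_ite_div_mul, div_le_iff₀ (by norm_num)]
    push_cast at h
    linarith
  sum_ampB_le b₀ b₁ y := by
    have h := (Nat.cast_le (α := ℝ)).2 (octagon_sum_ampB_le b₀ b₁ y)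
    rw [sum_ite_div_mul, div_le_iff₀ (by norm_num)]
    push_cast at h
    linarith

lemma sum_strategyWeight_le (n : ℕ) (a b : (Fin n → Bool) → (Fin n → Bool)) :
    ∑ x, ∑ y, strategyWeight (29 / 42) (a x) (b y) x y ≤ (13 / 14) ^ n * (2 ^ n * 2 ^ n) := by
  have h := octagonScheme.sum_strategyWeight_le (by norm_num) (by norm_num) n a b
    (fun _ => 1) (fun _ => 1) (fun _ => zero_le_one) (fun _ => zero_le_one)
  simp only [one_mul, one_pow, Finset.sum_const, Finset.card_univ, Fintype.card_pi,
    Fintype.card_bool, Finset.prod_const, Fintype.card_fin, nsmul_eq_mul, mul_one] at h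
  push_cast at h
  have h2 : (13 / 14 : ℝ) ^ n * (2 ^ n * 2 ^ n) = (13 / 7) ^ n * 2 ^ n := by
    rw [← mul_assoc, ← mul_pow]
    norm_num
  linarith

lemma strategyWeight_eq_exp {q : ℝ} (hq : 0 < q) {n : ℕ} (a b x y : Fin n → Bool) :
    strategyWeight q a b x y = Real.exp (Real.log q * (n - winCount n a b x y)) := by
  have hcard := Finset.card_filter_add_card_filter_not (s := (Finset.univ : Finset (Fin n)))
    (fun i => Bool.xor (a i) (b i) = (x i && y i))
  rw [Finset.card_univ, Fintype.card_fin] at hcard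
  have hn : (n : ℝ) - winCount n a b x y =
      (Finset.univ.filter fun i => ¬ Bool.xor (a i) (b i) = (x i && y i)).card := by
    rw [sub_eq_iff_eq_add', winCount]
    exact_mod_cast hcard.symm
  rw [hn, mul_comm, Real.exp_nat_mul, Real.exp_log hq, strategyWeight]
  simp only [copyWeight]
  rw [Finset.prod_ite, Finset.prod_const_one, one_mul, Finset.prod_const]

lemma prUniform_le_chernoff {q : ℝ} (hq0 : 0 < q) (hq1 : q ≤ 1) (n : ℕ) (θ : ℝ)
    (a b : (Fin n → Bool) → (Fin n → Bool)) :
    prUniform n (fun x y => θ * n ≤ (winCount n (a x) (b y) x y : ℝ)) *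
        Real.exp (Real.log q * ((1 - θ) * n)) ≤
      (∑ x, ∑ y, strategyWeight q (a x) (b y) x y) / (2 ^ n * 2 ^ n) := by
  rw [prUniform, div_mul_eq_mul_div]
  gcongr
  rw [← nsmul_eq_mul, ← Finset.sum_const, ← Fintype.sum_prod_type']
  refine (Finset.sum_le_sum fun p hp => ?_).trans (Finset.sum_le_sum_of_subset_of_nonneg
    (Finset.filter_subset _ _) fun p _ _ => strategyWeight_nonneg hq0.le _ _ _ _)
  rw [Finset.mem_filter] at hp
  rw [strategyWeight_eq_exp hq0]
  refine Real.exp_le_exp.2 (mul_le_mul_of_nonpos_left ?_ (Real.log_nonpos hq0.le hq1))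
  linarith [hp.2]

lemma chsh_exponent_le {ε : ℝ} (hε : 0 ≤ ε) (hε' : (1 + Real.sqrt 5) / 4 + ε ≤ 1) :
    Real.log (13 / 14) - Real.log (29 / 42) * (1 - ((1 + Real.sqrt 5) / 4 + ε)) ≤ -2 * ε ^ 2 := by
  set δ : ℝ := 1 - (1 + Real.sqrt 5) / 4 with hδ
  have hs : (2.236 : ℝ) < Real.sqrt 5 := Real.lt_sqrt_of_sq_lt (by norm_num)
  have hδ1 : δ < 0.191 := by rw [hδ]; linarith
  have hεδ : ε ≤ δ := by rw [hδ]; linarith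
  have hM : (2 / 27 : ℝ) < Real.log (14 / 13) := by
    have := Real.lt_log_one_add_of_pos (x := 1 / 13) (by norm_num)
    norm_num at this ⊢
    exact this
  have hM' : Real.log (13 / 14) = -Real.log (14 / 13) := by
    rw [← Real.log_inv]; norm_num
  have hL : -Real.log (29 / 42) ≤ 5 * Real.log (14 / 13) := by
    rw [← Real.log_inv]
    have : 5 * Real.log (14 / 13) = Real.log ((14 / 13) ^ 5) := by
      rw [Real.log_pow]; norm_num
    rw [this]
    exact Real.log_le_log (by norm_num) (by norm_num)
  rw [hM', show 1 - ((1 + Real.sqrt 5) / 4 + ε) = δ - ε by rw [hδ]; ring]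
  have h1 : -Real.log (29 / 42) * (δ - ε) ≤ 5 * Real.log (14 / 13) * (δ - ε) :=
    mul_le_mul_of_nonneg_right hL (by linarith)
  nlinarith

/-- The tail bound for the number of copies won without communication. -/
lemma prUniform_winCount_le (n : ℕ) (hn : 1 ≤ n) {ε : ℝ} (hε : 0 ≤ ε)
    (a b : (Fin n → Bool) → (Fin n → Bool)) :
    prUniform n (fun x y =>
        ((1 + Real.sqrt 5) / 4 + ε) * n ≤ (winCount n (a x) (b y) x y : ℝ)) ≤
      Real.exp (-2 * ε ^ 2 * n) := by
  have hn' : (0 : ℝ) < n := by exact_mod_cast hn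
  rcases le_or_gt ((1 + Real.sqrt 5) / 4 + ε) 1 with h1 | h1
  · have hC := (prUniform_le_chernoff (q := 29 / 42) (by norm_num) (by norm_num) n
      ((1 + Real.sqrt 5) / 4 + ε) a b).trans
      (div_le_of_le_mul₀ (by positivity) (by positivity) (sum_strategyWeight_le n a b))
    rw [← le_div_iff₀ (Real.exp_pos _)] at hC
    refine hC.trans ?_
    have hpow : (13 / 14 : ℝ) ^ n = Real.exp (n * Real.log (13 / 14)) := by
      rw [Real.exp_nat_mul, Real.exp_log (by norm_num)]
    rw [hpow, ← Real.exp_sub, Real.exp_le_exp]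
    nlinarith [mul_le_mul_of_nonneg_right (chsh_exponent_le hε h1) hn'.le]
  · have hempty : (Finset.univ.filter fun p : (Fin n → Bool) × (Fin n → Bool) =>
        ((1 + Real.sqrt 5) / 4 + ε) * n ≤ (winCount n (a p.1) (b p.2) p.1 p.2 : ℝ)) = ∅ := by
      refine Finset.filter_eq_empty_iff.2 fun p _ hp => ?_
      have hw : (winCount n (a p.1) (b p.2) p.1 p.2 : ℝ) ≤ n := by
        exact_mod_cast (Finset.card_filter_le _ _).trans_eq (Finset.card_fin n)
      nlinarith
    rw [prUniform, hempty, Finset.card_empty, Nat.cast_zero, zero_div]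
    exact (Real.exp_pos _).le

/-- A union bound over a finite family of events. -/
lemma prUniform_le_sum {ι : Type} [Fintype ι] (n : ℕ)
    (P : (Fin n → Bool) → (Fin n → Bool) → Prop)
    (Q : ι → (Fin n → Bool) → (Fin n → Bool) → Prop) (h : ∀ x y, P x y → ∃ k, Q k x y) :
    prUniform n P ≤ ∑ k, prUniform n (Q k) := by
  simp only [prUniform]
  rw [← Finset.sum_div]
  gcongr
  rw [← Nat.cast_sum, Nat.cast_le]
  refine (Finset.card_le_card fun p hp => ?_).trans Finset.card_biUnion_le
  obtain ⟨k, hk⟩ := h p.1 p.2 (Finset.mem_filter.1 hp).2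
  exact Finset.mem_biUnion.2 ⟨k, Finset.mem_univ _, Finset.mem_filter.2 ⟨Finset.mem_univ _, hk⟩⟩

/-- Corollary 3.2: a one-way communication strategy with shared randomness `r ~ ρ`, where
Alice sends a message taking one of `K` values, wins at least `((1+√5)/4 + ε)·n` out of `n`
CHSH copies with probability at most `K · exp(−2ε²n)`. -/
theorem chsh_threshold_communication_bound (n : ℕ) (hn : 1 ≤ n) (ε : ℝ) (hε : 0 < ε)
    (K : ℕ) (hK : 1 ≤ K)
    (R : Type) [Fintype R] (ρ : R → ℝ) (hρ0 : ∀ r, 0 ≤ ρ r) (hρ1 : ∑ r, ρ r = 1)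
    (a : R → (Fin n → Bool) → (Fin n → Bool))
    (m : R → (Fin n → Bool) → Fin K)
    (b : R → Fin K → (Fin n → Bool) → (Fin n → Bool)) :
    (∑ r, ρ r * prUniform n (fun x y =>
        ((1 + Real.sqrt 5) / 4 + ε) * n ≤ (winCount n (a r x) (b r (m r x) y) x y : ℝ))) ≤
      K * Real.exp (-2 * ε ^ 2 * n) := by
  have hr (r : R) : prUniform n (fun x y =>
      ((1 + Real.sqrt 5) / 4 + ε) * n ≤ (winCount n (a r x) (b r (m r x) y) x y : ℝ)) ≤
      K * Real.exp (-2 * ε ^ 2 * n) := by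
    refine (prUniform_le_sum n _ (fun (k : Fin K) x y =>
      ((1 + Real.sqrt 5) / 4 + ε) * n ≤ (winCount n (a r x) (b r k y) x y : ℝ))
      fun x y h => ⟨m r x, h⟩).trans ?_
    refine (Finset.sum_le_sum fun k _ => prUniform_winCount_le n hn hε.le (a r) (b r k)).trans_eq ?_
    simp
  calc _ ≤ ∑ r, ρ r * (K * Real.exp (-2 * ε ^ 2 * n)) :=
        Finset.sum_le_sum fun r _ => mul_le_mul_of_nonneg_left (hr r) (hρ0 r)
    _ = _ := by rw [← Finset.sum_mul, hρ1, one_mul]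
end

section
/- Let 𝒳, 𝒴, 𝒜, ℬ be finite sets, let q be a product probability distribution on 𝒳 × 𝒴, let V : 𝒳 × 𝒴 × 𝒜 × ℬ → {0,1} be any predicate, let K ≥ 1, and let R be a finite set with probability distribution ρ. Given any one-way communication strategy consisting of a : R × 𝒳 → 𝒜, m : R × 𝒳 → Fin K, and b : R × Fin K × 𝒴 → ℬ, there exist a finite set R' with a probability distribution ρ' and functions a' : R' × 𝒳 → 𝒜, b' : R' × 𝒴 → ℬ (a zero-communication strategy with shared randomness) such that Pr_{r'~ρ', (x,y)~q}[V(x, y, a'(r',x), b'(r',y)) = 1] ≥ (1/K) · Pr_{r~ρ, (x,y)~q}[V(x, y, a(r,x), b(r, m(r,x), y)) = 1]. -/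
open scoped Classical

/-- The message-guessing reduction inside Corollary 3.2: any one-way communication strategy
using a `K`-valued message, for a game with predicate `V` under a product input distribution
`qX ⊗ qY`, can be converted to a zero-communication strategy with shared randomness whose
winning probability is at least a `1/K` fraction of the original. -/
theorem one_way_to_zero_communication
    (𝒳 𝒴 𝒜 ℬ : Type) [Fintype 𝒳] [Fintype 𝒴] [Fintype 𝒜] [Fintype ℬ]
    (qX : 𝒳 → ℝ) (hqX0 : ∀ x, 0 ≤ qX x) (hqX1 : ∑ x, qX x = 1)
    (qY : 𝒴 → ℝ) (hqY0 : ∀ y, 0 ≤ qY y) (hqY1 : ∑ y, qY y = 1)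
    (V : 𝒳 → 𝒴 → 𝒜 → ℬ → Bool)
    (K : ℕ) (hK : 1 ≤ K)
    (R : Type) [Fintype R] (ρ : R → ℝ) (hρ0 : ∀ r, 0 ≤ ρ r) (hρ1 : ∑ r, ρ r = 1)
    (a : R → 𝒳 → 𝒜) (m : R → 𝒳 → Fin K) (b : R → Fin K → 𝒴 → ℬ) :
    ∃ (R' : Type) (instR' : Fintype R') (ρ' : R' → ℝ)
      (a' : R' → 𝒳 → 𝒜) (b' : R' → 𝒴 → ℬ),
      (∀ r', 0 ≤ ρ' r') ∧
      (∑ r' ∈ @Finset.univ R' instR', ρ' r') = 1 ∧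
      (1 / K : ℝ) * (∑ r, ∑ x, ∑ y, ρ r * (qX x * qY y) *
          (if V x y (a r x) (b r (m r x) y) = true then (1 : ℝ) else 0)) ≤
        ∑ r' ∈ @Finset.univ R' instR', ∑ x, ∑ y, ρ' r' * (qX x * qY y) *
          (if V x y (a' r' x) (b' r' y) = true then (1 : ℝ) else 0) := by
  have hK0 : (K : ℝ) ≠ 0 := by exact_mod_cast (by omega : K ≠ 0)
  refine ⟨R × Fin K, inferInstance, fun p => ρ p.1 / K, fun p => a p.1, fun p => b p.1 p.2,
    fun p => div_nonneg (hρ0 p.1) K.cast_nonneg, ?_, ?_⟩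
  · simp [Fintype.sum_prod_type, mul_div_cancel₀, hK0, hρ1]
  · rw [Fintype.sum_prod_type, Finset.mul_sum]
    refine Finset.sum_le_sum fun r _ => ?_
    rw [Finset.mul_sum, Finset.sum_comm]
    refine Finset.sum_le_sum fun x _ => ?_
    -- Only the correct guess `k = m r x` is needed; the other terms are nonnegative.
    refine le_trans (le_of_eq ?_) (Finset.single_le_sum
      (f := fun k => ∑ y, ρ r / K * (qX x * qY y) *
        (if V x y (a r x) (b r k y) = true then (1 : ℝ) else 0))
      (fun k _ => ?_) (Finset.mem_univ (m r x)))
    · rw [Finset.mul_sum]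
      refine Finset.sum_congr rfl fun y _ => ?_
      ring
    · refine Finset.sum_nonneg fun y _ => mul_nonneg (mul_nonneg
        (div_nonneg (hρ0 r) K.cast_nonneg) (mul_nonneg (hqX0 x) (hqY0 y))) ?_
      split_ifs <;> norm_num
end

section
/- Let 𝒳, 𝒴, 𝒵, ℳ, S be finite sets, let p_X and p_Y be probability distributions on 𝒳 and 𝒴 (so the input distribution on 𝒳 × 𝒴 is the product p_X ⊗ p_Y), and let R ⊆ 𝒳 × 𝒴 × 𝒵 be a relation. Consider a one-way private-coin protocol: Alice samples private randomness s from a distribution on S, sends M = m(s, X) ∈ ℳ, and Bob outputs z = b(M, Y) ∈ 𝒵; suppose Pr[(X, Y, b(m(s,X), Y)) ∈ R] = α, and suppose I_s^β(X : M) ≤ c for some β ∈ (0, α/2], where the joint distribution of (X, M) is induced by X ~ p_X and s. Then there exist a natural number K with log₂ K ≤ c + log₂(2/β) + log₂ log₂(2/β), and deterministic functions m' : 𝒳 → Fin K and b' : Fin K × 𝒴 → 𝒵 such that Pr_{(x,y)~p_X⊗p_Y}[(x, y, b'(m'(x), y)) ∈ R] ≥ α − 2β. -/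
open scoped Classical

/-- Marginal on the first coordinate of a joint distribution. -/
noncomputable def margX {𝒳 ℳ : Type} [Fintype ℳ] (p : 𝒳 × ℳ → ℝ) (x : 𝒳) : ℝ :=
  ∑ μ, p (x, μ)

/-- Marginal on the second coordinate of a joint distribution. -/
noncomputable def margM {𝒳 ℳ : Type} [Fintype 𝒳] (p : 𝒳 × ℳ → ℝ) (μ : ℳ) : ℝ :=
  ∑ x, p (x, μ)

/-- The `β`-smoothed spectrum max-information `I_s^β(X:M)` of a joint distribution `p` on
`𝒳 × ℳ`: the infimum of `c` such that `Pr_{(x,m)~p}[p(x,m) > 2^c · p_X(x) · p_M(m)] ≤ β`. -/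
noncomputable def Ispec {𝒳 ℳ : Type} [Fintype 𝒳] [Fintype ℳ] (β : ℝ) (p : 𝒳 × ℳ → ℝ) : ℝ :=
  sInf {c : ℝ |
    (∑ z ∈ Finset.univ.filter
        (fun z : 𝒳 × ℳ => (2 : ℝ) ^ c * margX p z.1 * margM p z.2 < p z), p z) ≤ β}

/-- Some value of a function is at least its weighted average. -/
lemma exists_weighted_sum_le {ι : Type*} [Fintype ι] {r : ι → ℝ} (hr0 : ∀ i, 0 ≤ r i)
    (hr1 : ∑ i, r i = 1) (f : ι → ℝ) : ∃ i, ∑ j, r j * f j ≤ f i := by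
  by_contra! h
  obtain ⟨i, -, hne⟩ := Finset.exists_ne_zero_of_sum_ne_zero (hr1.trans_ne one_ne_zero)
  have hi : 0 < r i := (hr0 i).lt_of_ne' hne
  have hlt : ∑ j, r j * f j < ∑ j, r j * ∑ k, r k * f k :=
    Finset.sum_lt_sum (fun j _ => mul_le_mul_of_nonneg_left (h j).le (hr0 j))
      ⟨i, Finset.mem_univ i, mul_lt_mul_of_pos_left (h i) hi⟩
  rw [← Finset.sum_mul, hr1, one_mul] at hlt
  exact lt_irrefl _ hlt

/-- Derandomized rejection sampling: there is a codebook of `K` messages whose best entries are, on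
average over the input, as good as `K` rounds of rejection sampling with proposal distribution `r`
and acceptance probabilities `w`, starting from the fallback value `F`. -/
lemma exists_codebook {X M : Type*} [Fintype X] [Fintype M] {p : X → ℝ} {r : M → ℝ}
    (hr0 : ∀ μ, 0 ≤ r μ) (hr1 : ∑ μ, r μ = 1) {w : X → M → ℝ} (hw0 : ∀ x μ, 0 ≤ w x μ)
    (hw1 : ∀ x μ, w x μ ≤ 1) (f : X → M → ℝ) (K : ℕ) (F : X → ℝ) :
    ∃ (code : Fin K → M) (H : X → ℝ), (∀ x, H x ≤ F x ∨ ∃ i, H x ≤ f x (code i)) ∧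
      ∑ x, p x * ((∑ μ, r μ * (w x μ * f x μ)) * ∑ j ∈ Finset.range K, (1 - ∑ μ, r μ * w x μ) ^ j
        + (1 - ∑ μ, r μ * w x μ) ^ K * F x) ≤ ∑ x, p x * H x := by
  induction K generalizing F with
  | zero => exact ⟨Fin.elim0, F, fun x => .inl le_rfl, by simp⟩
  | succ K ih =>
    set a : X → ℝ := fun x => ∑ μ, r μ * (w x μ * f x μ)
    set k : X → ℝ := fun x => 1 - ∑ μ, r μ * w x μ
    let G : M → X → ℝ := fun μ x => w x μ * f x μ + (1 - w x μ) * F x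
    have hG : ∀ x, ∑ μ, r μ * G μ x = a x + k x * F x := by
      intro x
      calc ∑ μ, r μ * G μ x
          = ∑ μ, (r μ * (w x μ * f x μ) + (r μ - r μ * w x μ) * F x) :=
            Finset.sum_congr rfl fun μ _ => by simp only [G]; ring
        _ = a x + k x * F x := by
            rw [Finset.sum_add_distrib, ← Finset.sum_mul, Finset.sum_sub_distrib, hr1]
    obtain ⟨μ, hμ⟩ := exists_weighted_sum_le hr0 hr1 fun μ =>
      ∑ x, p x * (a x * ∑ j ∈ Finset.range K, k x ^ j + k x ^ K * G μ x)
    obtain ⟨code, H, hH, hle⟩ := ih (G μ)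
    refine ⟨Fin.cons μ code, H, fun x => ?_, le_trans (le_of_eq ?_) (hμ.trans hle)⟩
    · rcases hH x with h | ⟨i, hi⟩
      · by_cases hF : H x ≤ F x
        · exact .inl hF
        · refine .inr ⟨0, ?_⟩
          rw [Fin.cons_zero]
          by_contra! hf
          push Not at hF
          simp only [G] at h
          rcases (hw0 x μ).eq_or_lt with h0 | h0
          · rw [← h0] at h; linarith
          · nlinarith [mul_pos h0 (sub_pos.2 hf),
              mul_nonneg (sub_nonneg.2 (hw1 x μ)) (sub_pos.2 hF).le]
      · exact .inr ⟨i.succ, by rwa [Fin.cons_succ]⟩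
    · simp_rw [Finset.mul_sum (Finset.univ : Finset X)]
      rw [Finset.sum_comm]
      refine Finset.sum_congr rfl fun x _ => ?_
      calc p x * (a x * ∑ j ∈ Finset.range (K + 1), k x ^ j + k x ^ (K + 1) * F x)
          = p x * (a x * ∑ j ∈ Finset.range K, k x ^ j) * ∑ μ, r μ
              + p x * k x ^ K * ∑ μ, r μ * G μ x := by
            rw [hG, hr1, Finset.sum_range_succ]; ring
        _ = _ := by
            generalize ∑ j ∈ Finset.range K, k x ^ j = S
            rw [Finset.mul_sum, Finset.mul_sum, ← Finset.sum_add_distrib]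
            exact Finset.sum_congr rfl fun μ _ => by ring

/-- After `K ≥ (t / β) log (1 / β)` rounds, each accepting with probability `g / t` and gaining
`s / t` on average, rejection sampling loses at most `β` of the gain `s`. -/
lemma sub_le_mul_geom_sum {s g t β : ℝ} {K : ℕ} (hs0 : 0 ≤ s) (hsg : s ≤ g) (hg1 : g ≤ 1)
    (ht : 0 < t) (hgt : g / t ≤ 1) (hβ : 0 < β) (hK : t / β * Real.log (1 / β) ≤ K) :
    s - β ≤ s / t * ∑ j ∈ Finset.range K, (1 - g / t) ^ j := by
  have hk0 : 0 ≤ 1 - g / t := by linarith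
  rcases le_or_gt g β with h | h
  · have : 0 ≤ s / t * ∑ j ∈ Finset.range K, (1 - g / t) ^ j :=
      mul_nonneg (div_nonneg hs0 ht.le) (Finset.sum_nonneg fun j _ => pow_nonneg hk0 j)
    linarith
  · have hg : 0 < g := hβ.trans h
    have hgeom : s / t * ∑ j ∈ Finset.range K, (1 - g / t) ^ j
        = s / g * (1 - (1 - g / t) ^ K) := by
      have := geom_sum_mul_neg (1 - g / t) K
      rw [← this]
      field_simp
      ring
    have hpow : (1 - g / t) ^ K ≤ β := by
      calc (1 - g / t) ^ K ≤ Real.exp (-(g / t)) ^ K :=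
            pow_le_pow_left₀ hk0 (Real.one_sub_le_exp_neg _) K
        _ = Real.exp (-(K * (g / t))) := by rw [← Real.exp_nat_mul]; ring_nf
        _ ≤ Real.exp (Real.log β) := by
            rw [Real.exp_le_exp]
            have h1 : Real.log (1 / β) ≤ K * (β / t) := by
              calc Real.log (1 / β) = t / β * Real.log (1 / β) * (β / t) := by field_simp
                _ ≤ K * (β / t) := by gcongr
            have h2 : (K : ℝ) * (β / t) ≤ K * (g / t) := by gcongr
            rw [one_div, Real.log_inv] at h1
            linarith
        _ = β := Real.exp_log hβ
    have hsg1 : s / g ≤ 1 := (div_le_one hg).2 hsg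
    have hss : s ≤ s / g := le_div_self hs0 hg hg1
    have h0 : 0 ≤ s / g := div_nonneg hs0 hg.le
    have hp0 := pow_nonneg hk0 K
    rw [hgeom]
    nlinarith [mul_le_mul hsg1 hpow hp0 zero_le_one]

/-- For a probability distribution and `β < 1`, the infimum defining `Ispec` is attained, and every
larger value is feasible. -/
lemma sum_filter_le_of_Ispec_le {X M : Type} [Fintype X] [Fintype M] {β c : ℝ} (hβ0 : 0 ≤ β)
    (hβ1 : β < 1) {p : X × M → ℝ} (hp0 : ∀ z, 0 ≤ p z) (hp1 : ∑ z, p z = 1)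
    (hI : Ispec β p ≤ c) :
    ∑ z ∈ Finset.univ.filter
      (fun z : X × M => (2 : ℝ) ^ c * margX p z.1 * margM p z.2 < p z), p z ≤ β := by
  have hX : ∀ z, p z ≤ margX p z.1 := fun z =>
    Finset.single_le_sum (f := fun μ => p (z.1, μ)) (fun μ _ => hp0 _) (Finset.mem_univ z.2)
  have hM : ∀ z, p z ≤ margM p z.2 := fun z =>
    Finset.single_le_sum (f := fun x => p (x, z.2)) (fun x _ => hp0 _) (Finset.mem_univ z.1)
  set E : ℝ → Finset (X × M) := fun c => Finset.univ.filter
    (fun z : X × M => (2 : ℝ) ^ c * margX p z.1 * margM p z.2 < p z) with hE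
  set S : Set ℝ := {c | ∑ z ∈ E c, p z ≤ β} with hS
  have hmono : ∀ {c d}, E c ⊆ E d → ∑ z ∈ E c, p z ≤ ∑ z ∈ E d, p z := fun h =>
    Finset.sum_le_sum_of_subset_of_nonneg h fun z _ _ => hp0 z
  have hmX1 : ∑ x, margX p x = 1 := by rw [← hp1, Fintype.sum_prod_type]; rfl
  have hmM1 : ∑ μ, margM p μ = 1 := by rw [← hp1, Fintype.sum_prod_type_right]; rfl
  have hbdd : BddBelow S := by
    refine ⟨Real.logb 2 (1 - β), fun c hc => ?_⟩
    rw [Real.logb_le_iff_le_rpow one_lt_two (by linarith)]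
    have hcompl : ∑ z ∈ Finset.univ.filter
        (fun z : X × M => ¬ (2 : ℝ) ^ c * margX p z.1 * margM p z.2 < p z), p z ≤ 2 ^ c := by
      calc _ ≤ ∑ z ∈ Finset.univ.filter
              (fun z : X × M => ¬ (2 : ℝ) ^ c * margX p z.1 * margM p z.2 < p z),
              (2 : ℝ) ^ c * margX p z.1 * margM p z.2 :=
            Finset.sum_le_sum fun z hz => not_lt.1 (Finset.mem_filter.1 hz).2
        _ ≤ ∑ z : X × M, (2 : ℝ) ^ c * margX p z.1 * margM p z.2 :=
            Finset.sum_le_sum_of_subset_of_nonneg (Finset.filter_subset _ _) fun z _ _ =>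
              mul_nonneg (mul_nonneg (by positivity) ((hp0 z).trans (hX z))) ((hp0 z).trans (hM z))
        _ = 2 ^ c := by
            rw [Fintype.sum_prod_type]
            simp_rw [← Finset.mul_sum, hmM1, mul_one]
            rw [← Finset.mul_sum, hmX1, mul_one]
    have hsplit := Finset.sum_filter_add_sum_filter_not Finset.univ
      (fun z : X × M => (2 : ℝ) ^ c * margX p z.1 * margM p z.2 < p z) p
    rw [hp1] at hsplit
    have hc' : ∑ z ∈ E c, p z ≤ β := hc
    simp only [hE] at hc'
    linarith
  have hne : S.Nonempty := by
    have hev : ∀ z, ∀ᶠ c : ℝ in Filter.atTop, p z ≤ 2 ^ c * margX p z.1 * margM p z.2 := by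
      intro z
      rcases (hp0 z).eq_or_lt with h | h
      · refine Filter.Eventually.of_forall fun c => ?_
        rw [← h]
        exact mul_nonneg (mul_nonneg (by positivity) ((hp0 z).trans (hX z))) ((hp0 z).trans (hM z))
      · have hpos : 0 < margX p z.1 * margM p z.2 :=
          mul_pos (h.trans_le (hX z)) (h.trans_le (hM z))
        filter_upwards [Filter.eventually_ge_atTop
          (Real.logb 2 (p z / (margX p z.1 * margM p z.2)))] with c hc
        rw [Real.logb_le_iff_le_rpow one_lt_two (div_pos h hpos), div_le_iff₀ hpos] at hc
        linarith
    obtain ⟨c, hc⟩ := (Filter.eventually_all.2 hev).exists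
    refine ⟨c, ?_⟩
    have : E c = ∅ := Finset.filter_eq_empty_iff.2 fun z _ => not_lt.2 (hc z)
    simpa [hS, this] using hβ0
  have hclosed : IsClosed S := by
    rw [← isOpen_compl_iff, isOpen_iff_mem_nhds]
    intro c hc
    have hev : ∀ᶠ d in nhds c, ∀ z ∈ E c, z ∈ E d := by
      rw [Filter.eventually_all_finset]
      intro z hz
      have hcont : Continuous fun d : ℝ => (2 : ℝ) ^ d * margX p z.1 * margM p z.2 :=
        ((Real.continuous_const_rpow two_ne_zero).mul_const _).mul_const _
      filter_upwards [hcont.continuousAt.eventually_lt continuousAt_const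
        (Finset.mem_filter.1 hz).2] with d hd
      exact Finset.mem_filter.2 ⟨Finset.mem_univ _, hd⟩
    filter_upwards [hev] with d hd hdS
    exact hc ((hmono hd).trans hdS)
  have hmem : ∑ z ∈ E (sInf S), p z ≤ β := hclosed.csInf_mem hne hbdd
  refine (hmono fun z hz => ?_).trans hmem
  refine Finset.mem_filter.2 ⟨Finset.mem_univ _, lt_of_le_of_lt ?_ (Finset.mem_filter.1 hz).2⟩
  have hX0 := (hp0 z).trans (hX z)
  have hM0 := (hp0 z).trans (hM z)
  have hle : (2 : ℝ) ^ sInf S ≤ 2 ^ c := Real.rpow_le_rpow_of_exponent_le one_le_two hI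
  gcongr

/-- One-way compression for an abstract payoff `f x μ` of sending `μ` on input `x`: if the message
distribution `q x` exceeds `t` times the proposal `r` with probability at most `β`, then some
codebook of size `K ≥ (t / β) log (1 / β)` loses at most `2 β`. -/
lemma exists_encoding {X M : Type*} [Fintype X] [Fintype M] {p : X → ℝ} (hp0 : ∀ x, 0 ≤ p x)
    (hp1 : ∑ x, p x = 1) {q : X → M → ℝ} (hq0 : ∀ x μ, 0 ≤ q x μ) (hq1 : ∀ x, ∑ μ, q x μ = 1)
    {r : M → ℝ} (hr0 : ∀ μ, 0 ≤ r μ) (hr1 : ∑ μ, r μ = 1) {f : X → M → ℝ}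
    (hf0 : ∀ x μ, 0 ≤ f x μ) (hf1 : ∀ x μ, f x μ ≤ 1) {t β : ℝ} (ht : 0 < t) (hβ : 0 < β)
    (hbad : ∑ x, p x * ∑ μ, (if q x μ ≤ t * r μ then 0 else q x μ) ≤ β)
    {K : ℕ} (hK0 : 0 < K) (hK : t / β * Real.log (1 / β) ≤ K) :
    ∃ (code : Fin K → M) (enc : X → Fin K),
      ∑ x, p x * ∑ μ, q x μ * f x μ - 2 * β ≤ ∑ x, p x * f x (code (enc x)) := by
  let v : X → M → ℝ := fun x μ => if q x μ ≤ t * r μ then q x μ else 0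
  let w : X → M → ℝ := fun x μ => v x μ / (t * r μ)
  have htr : ∀ μ, 0 ≤ t * r μ := fun μ => mul_nonneg ht.le (hr0 μ)
  have hv0 : ∀ x μ, 0 ≤ v x μ := fun x μ => by
    simp only [v]; split_ifs; exacts [hq0 x μ, le_rfl]
  have hvq : ∀ x μ, v x μ ≤ q x μ := fun x μ => by
    simp only [v]; split_ifs; exacts [le_rfl, hq0 x μ]
  have hvr : ∀ x μ, v x μ ≤ t * r μ := fun x μ => by
    simp only [v]; split_ifs with h; exacts [h, htr μ]
  have hw0 : ∀ x μ, 0 ≤ w x μ := fun x μ => div_nonneg (hv0 x μ) (htr μ)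
  have hw1 : ∀ x μ, w x μ ≤ 1 := fun x μ => div_le_one_of_le₀ (hvr x μ) (htr μ)
  have hrw : ∀ x μ, r μ * w x μ = v x μ / t := by
    intro x μ
    rcases (hr0 μ).eq_or_lt with h | h
    · have : v x μ = 0 := le_antisymm (by simpa [← h] using hvr x μ) (hv0 x μ)
      simp [w, this]
    · simp only [w]; field_simp
  have hacc : ∀ x, ∑ μ, r μ * w x μ = (∑ μ, v x μ) / t := fun x => by
    simp_rw [hrw, Finset.sum_div]
  have hgain : ∀ x, ∑ μ, r μ * (w x μ * f x μ) = (∑ μ, v x μ * f x μ) / t := fun x => by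
    rw [Finset.sum_div]
    exact Finset.sum_congr rfl fun μ _ => by rw [← mul_assoc, hrw]; ring
  obtain ⟨code, H, hH, hle⟩ := exists_codebook (p := p) hr0 hr1 hw0 hw1 f K 0
  have henc : ∀ x, ∃ i, H x ≤ f x (code i) := fun x =>
    (hH x).elim (fun h => ⟨⟨0, hK0⟩, h.trans (hf0 _ _)⟩) id
  choose enc henc using henc
  refine ⟨code, enc, ?_⟩
  calc ∑ x, p x * ∑ μ, q x μ * f x μ - 2 * β
      ≤ ∑ x, p x * ∑ μ, v x μ * f x μ - β := by
        have : ∑ x, p x * ∑ μ, q x μ * f x μ ≤ ∑ x, p x * ∑ μ, v x μ * f x μ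
            + ∑ x, p x * ∑ μ, (if q x μ ≤ t * r μ then 0 else q x μ) := by
          simp_rw [← Finset.sum_add_distrib, ← mul_add, ← Finset.sum_add_distrib]
          refine Finset.sum_le_sum fun x _ => mul_le_mul_of_nonneg_left
            (Finset.sum_le_sum fun μ _ => ?_) (hp0 x)
          simp only [v]
          split_ifs
          · simp
          · simpa using mul_le_of_le_one_right (hq0 x μ) (hf1 x μ)
        linarith
    _ = ∑ x, p x * (∑ μ, v x μ * f x μ - β) := by
        simp_rw [mul_sub]
        rw [Finset.sum_sub_distrib, ← Finset.sum_mul, hp1, one_mul]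
    _ ≤ _ := Finset.sum_le_sum fun x _ => mul_le_mul_of_nonneg_left ?_ (hp0 x)
    _ ≤ _ := hle
    _ ≤ _ := Finset.sum_le_sum fun x _ => mul_le_mul_of_nonneg_left (henc x) (hp0 x)
  rw [hacc, hgain, Pi.zero_apply, mul_zero, add_zero]
  refine sub_le_mul_geom_sum (Finset.sum_nonneg fun μ _ => mul_nonneg (hv0 x μ) (hf0 x μ))
    (Finset.sum_le_sum fun μ _ => mul_le_of_le_one_right (hv0 x μ) (hf1 x μ))
    ((Finset.sum_le_sum fun μ _ => hvq x μ).trans (hq1 x).le) ht ?_ hβ hK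
  rw [← hacc, ← hr1]
  exact Finset.sum_le_sum fun μ _ => mul_le_of_le_one_right (hr0 μ) (hw1 x μ)

/-- There is an integer between the number of rejection sampling rounds that suffice and the
claimed codebook size. -/
lemma exists_codebook_size {c β : ℝ} (hβ0 : 0 < β) (hβ : β ≤ 1 / 2) (hc : 1 / 2 ≤ (2 : ℝ) ^ c) :
    ∃ K : ℕ, 0 < K ∧ (2 : ℝ) ^ c / β * Real.log (1 / β) ≤ K ∧
      Real.logb 2 K ≤ c + Real.logb 2 (2 / β) + Real.logb 2 (Real.logb 2 (2 / β)) := by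
  set t : ℝ := 2 ^ c with ht
  set L := Real.logb 2 (2 / β) with hL
  have ht0 : 0 < t := by positivity
  have h4 : 4 ≤ 2 / β := by rw [le_div_iff₀ hβ0]; linarith
  have hL2 : 2 ≤ L := by
    rw [hL, Real.le_logb_iff_rpow_le one_lt_two (by positivity)]
    norm_num
    linarith
  have hlog : Real.log (1 / β) ≤ L := by
    have h1 : Real.log (1 / β) ≤ Real.log (2 / β) :=
      Real.log_le_log (by positivity) (by gcongr; norm_num)
    have h2 : Real.log (2 / β) ≤ L := by
      rw [hL, Real.logb]
      exact le_div_self (Real.log_nonneg (by linarith)) (Real.log_pos one_lt_two)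
        (by linarith [Real.log_two_lt_d9])
    exact h1.trans h2
  have htβ : 1 ≤ t / β := by rw [le_div_iff₀ hβ0]; linarith
  have hnum : t / β * L + 1 ≤ t * (2 / β) * L := by
    have : t * (2 / β) * L = 2 * (t / β * L) := by ring
    nlinarith
  have hfloor := Nat.lt_floor_add_one (t * (2 / β) * L)
  have hKle : t / β * Real.log (1 / β) ≤ ⌊t * (2 / β) * L⌋₊ := by
    have : t / β * Real.log (1 / β) ≤ t / β * L := by gcongr
    linarith
  have hpos : 0 < ⌊t * (2 / β) * L⌋₊ := Nat.floor_pos.2 (by nlinarith)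
  refine ⟨_, hpos, hKle, ?_⟩
  have hle : (⌊t * (2 / β) * L⌋₊ : ℝ) ≤ t * (2 / β) * L := Nat.floor_le (by positivity)
  refine (Real.logb_le_logb_of_le one_lt_two (by exact_mod_cast hpos) hle).trans (le_of_eq ?_)
  rw [Real.logb_mul (by positivity) (by positivity), Real.logb_mul (by positivity) (by positivity),
    ht, Real.logb_rpow two_pos (by norm_num)]

/-- Fact 3.5 (Jain–Radhakrishnan–Sen, Jain): one-way message compression. A one-way
private-coin protocol (Alice samples `s ~ σ`, sends `M = m(s, X)`, Bob outputs
`b(M, Y)`) with success probability `α` for a relation `Rel` under a product input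
distribution, whose message satisfies `I_s^β(X : M) ≤ c` for some `β ∈ (0, α/2]`, can be
converted into a deterministic one-way protocol with communication at most
`c + log₂(2/β) + log₂ log₂(2/β)` bits and success probability at least `α − 2β`. -/
theorem one_way_message_compression
    (𝒳 𝒴 𝒵 ℳ S : Type) [Fintype 𝒳] [Fintype 𝒴] [Fintype 𝒵] [Fintype ℳ] [Fintype S]
    (pX : 𝒳 → ℝ) (hpX0 : ∀ x, 0 ≤ pX x) (hpX1 : ∑ x, pX x = 1)
    (pY : 𝒴 → ℝ) (hpY0 : ∀ y, 0 ≤ pY y) (hpY1 : ∑ y, pY y = 1)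
    (Rel : Set (𝒳 × 𝒴 × 𝒵))
    (σ : S → ℝ) (hσ0 : ∀ s, 0 ≤ σ s) (hσ1 : ∑ s, σ s = 1)
    (m : S → 𝒳 → ℳ) (b : ℳ → 𝒴 → 𝒵)
    (α : ℝ)
    (hα : (∑ s, ∑ x, ∑ y, σ s * (pX x * pY y) *
        (if (x, y, b (m s x) y) ∈ Rel then (1 : ℝ) else 0)) = α)
    (β c : ℝ) (hβ0 : 0 < β) (hβα : β ≤ α / 2)
    (hI : Ispec β (fun z : 𝒳 × ℳ =>
        pX z.1 * ∑ s, σ s * (if m s z.1 = z.2 then (1 : ℝ) else 0)) ≤ c) :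
    ∃ K : ℕ,
      Real.logb 2 K ≤ c + Real.logb 2 (2 / β) + Real.logb 2 (Real.logb 2 (2 / β)) ∧
      ∃ (m' : 𝒳 → Fin K) (b' : Fin K → 𝒴 → 𝒵),
        α - 2 * β ≤ ∑ x, ∑ y, (pX x * pY y) *
          (if (x, y, b' (m' x) y) ∈ Rel then (1 : ℝ) else 0) := by
  have hindicator : ∀ P : Prop, (0 : ℝ) ≤ (if P then 1 else 0) ∧ (if P then (1 : ℝ) else 0) ≤ 1 :=
    fun P => by split_ifs <;> norm_num
  set q : 𝒳 → ℳ → ℝ := fun x μ => ∑ s, σ s * (if m s x = μ then (1 : ℝ) else 0) with hq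
  set f : 𝒳 → ℳ → ℝ := fun x μ => ∑ y, pY y * (if (x, y, b μ y) ∈ Rel then (1 : ℝ) else 0) with hf
  set p : 𝒳 × ℳ → ℝ := fun z => pX z.1 * q z.1 z.2 with hp
  have hq0 : ∀ x μ, 0 ≤ q x μ := fun x μ =>
    Finset.sum_nonneg fun s _ => mul_nonneg (hσ0 s) (hindicator _).1
  have hqsum : ∀ x (g : ℳ → ℝ), ∑ μ, q x μ * g μ = ∑ s, σ s * g (m s x) := by
    intro x g
    simp only [hq, Finset.sum_mul]
    rw [Finset.sum_comm]
    simp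
  have hq1 : ∀ x, ∑ μ, q x μ = 1 := fun x => by simpa [hσ1] using hqsum x 1
  have hf0 : ∀ x μ, 0 ≤ f x μ := fun x μ =>
    Finset.sum_nonneg fun y _ => mul_nonneg (hpY0 y) (hindicator _).1
  have hf1 : ∀ x μ, f x μ ≤ 1 := fun x μ => by
    rw [← hpY1]
    exact Finset.sum_le_sum fun y _ => mul_le_of_le_one_right (hpY0 y) (hindicator _).2
  have hp0 : ∀ z, 0 ≤ p z := fun z => mul_nonneg (hpX0 _) (hq0 _ _)
  have hmargX : ∀ x, margX p x = pX x := fun x => by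
    simp only [margX, hp, ← Finset.mul_sum, hq1, mul_one]
  have hp1 : ∑ z, p z = 1 := by
    rw [Fintype.sum_prod_type, ← hpX1]
    exact Finset.sum_congr rfl fun x _ => hmargX x
  have hr0 : ∀ μ, 0 ≤ margM p μ := fun μ => Finset.sum_nonneg fun x _ => hp0 _
  have hr1 : ∑ μ, margM p μ = 1 := by rw [← hp1, Fintype.sum_prod_type_right]; rfl
  have hα' : ∑ x, pX x * ∑ μ, q x μ * f x μ = α := by
    rw [← hα, Finset.sum_comm]
    refine Finset.sum_congr rfl fun x _ => ?_
    rw [hqsum, Finset.mul_sum]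
    refine Finset.sum_congr rfl fun s _ => ?_
    simp only [hf, Finset.mul_sum]
    exact Finset.sum_congr rfl fun y _ => by ring
  have hα1 : α ≤ 1 := by
    rw [← hα', ← hpX1]
    refine Finset.sum_le_sum fun x _ => mul_le_of_le_one_right (hpX0 x) ?_
    rw [← hq1 x]
    exact Finset.sum_le_sum fun μ _ => mul_le_of_le_one_right (hq0 x μ) (hf1 x μ)
  have hspec := sum_filter_le_of_Ispec_le hβ0.le (by linarith) hp0 hp1 hI
  have hbad : ∑ x, pX x * ∑ μ, (if q x μ ≤ 2 ^ c * margM p μ then 0 else q x μ) ≤ β := by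
    refine le_trans (le_of_eq ?_) hspec
    rw [Finset.sum_filter, Fintype.sum_prod_type]
    refine Finset.sum_congr rfl fun x _ => ?_
    rw [Finset.mul_sum]
    refine Finset.sum_congr rfl fun μ _ => ?_
    rw [hmargX]
    rcases (hpX0 x).eq_or_lt with h | h
    · simp [hp, ← h]
    · have : (2 : ℝ) ^ c * pX x * margM p μ < p (x, μ) ↔ ¬ q x μ ≤ 2 ^ c * margM p μ := by
        rw [not_le, mul_right_comm, mul_comm _ (pX x)]
        exact mul_lt_mul_iff_right₀ h
      have hpz : p (x, μ) = pX x * q x μ := rfl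
      simp only [this]
      by_cases hle : q x μ ≤ 2 ^ c * margM p μ <;> simp [hle, hpz]
  have hc : (1 : ℝ) / 2 ≤ 2 ^ c := by
    have h1 : (1 : ℝ) ≤ ∑ x, pX x * ∑ μ, (if q x μ ≤ 2 ^ c * margM p μ then 0 else q x μ)
        + 2 ^ c := by
      calc (1 : ℝ) = ∑ x, pX x * ∑ μ, q x μ := by simp [hq1, hpX1]
        _ ≤ ∑ x, pX x * ∑ μ, ((if q x μ ≤ 2 ^ c * margM p μ then 0 else q x μ)
              + 2 ^ c * margM p μ) := by
            refine Finset.sum_le_sum fun x _ => mul_le_mul_of_nonneg_left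
              (Finset.sum_le_sum fun μ _ => ?_) (hpX0 x)
            have := mul_nonneg (Real.rpow_nonneg zero_le_two c) (hr0 μ)
            split_ifs <;> linarith
        _ = _ := by
            simp_rw [Finset.sum_add_distrib, mul_add]
            rw [Finset.sum_add_distrib]
            simp_rw [← Finset.mul_sum, hr1, mul_one]
            rw [← Finset.sum_mul, hpX1, one_mul]
    linarith
  obtain ⟨K, hK0, hK, hlogK⟩ := exists_codebook_size hβ0 (by linarith) hc
  obtain ⟨code, enc, hle⟩ := exists_encoding hpX0 hpX1 hq0 hq1 hr0 hr1 hf0 hf1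
    (Real.rpow_pos_of_pos two_pos c) hβ0 hbad hK0 hK
  refine ⟨K, hlogK, enc, fun i => b (code i), ?_⟩
  rw [hα'] at hle
  refine hle.trans (le_of_eq (Finset.sum_congr rfl fun x _ => ?_))
  simp only [hf, Finset.mul_sum, mul_assoc]
end

section
/- Let n ≥ 1, let X₁, …, Xₙ be Boolean random variables (not necessarily independent) on a common probability space, and let δ ∈ [0,1] be such that for every subset S ⊆ [n], Pr[ ∀ i ∈ S, X_i = 1 ] ≤ δ^{|S|}. Then for every γ ∈ [δ, 1], Pr[ Σ_{i=1}^n X_i ≥ γ·n ] ≤ e^{−2(γ−δ)²n}. -/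
open MeasureTheory

/-- **Hoeffding's lemma** for a Bernoulli variable of mean `δ`, in closed form. -/
lemma one_add_exp_sub_one_mul_le_exp {δ : ℝ} (hδ0 : 0 ≤ δ) (hδ1 : δ ≤ 1) (t : ℝ) :
    1 + (Real.exp t - 1) * δ ≤ Real.exp (t * δ + t ^ 2 / 8) := by
  let ν : Measure ℝ := ENNReal.ofReal δ • Measure.dirac 1 + ENNReal.ofReal (1 - δ) • Measure.dirac 0
  have integral_eq (f : ℝ → ℝ) : ∫ x, f x ∂ν = δ * f 1 + (1 - δ) * f 0 := by
    have hint (c a : ℝ) : Integrable f (ENNReal.ofReal c • Measure.dirac a) :=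
      (integrable_dirac (by simp)).smul_measure ENNReal.ofReal_ne_top
    rw [integral_add_measure (hint _ _) (hint _ _), integral_smul_measure, integral_smul_measure,
      integral_dirac, integral_dirac, ENNReal.toReal_ofReal hδ0,
      ENNReal.toReal_ofReal (sub_nonneg.2 hδ1), smul_eq_mul, smul_eq_mul]
  have : IsProbabilityMeasure ν := ⟨by
    simp [ν, ← ENNReal.ofReal_add hδ0 (sub_nonneg.2 hδ1)]⟩
  have hmem : ∀ᵐ x ∂ν, id x ∈ Set.Icc (0 : ℝ) 1 := by
    refine ae_add_measure_iff.2 ⟨?_, ?_⟩ <;>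
      exact Measure.ae_smul_measure ((ae_dirac_iff measurableSet_Icc).2 (by simp)) _
  have h := (ProbabilityTheory.hasSubgaussianMGF_of_mem_Icc aemeasurable_id hmem).mgf_le t
  have hmean : ∫ x, id x ∂ν = δ := by rw [integral_eq]; simp
  rw [hmean, ProbabilityTheory.mgf, integral_eq] at h
  have h' := mul_le_mul_of_nonneg_left h (Real.exp_pos (t * δ)).le
  have e1 : Real.exp (t * δ) * (δ * Real.exp (t * (id 1 - δ)) +
      (1 - δ) * Real.exp (t * (id 0 - δ))) = 1 + (Real.exp t - 1) * δ := by
    have a : Real.exp (t * δ) * Real.exp (t * (1 - δ)) = Real.exp t := by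
      rw [← Real.exp_add]; ring_nf
    have b : Real.exp (t * δ) * Real.exp (t * (0 - δ)) = 1 := by
      rw [← Real.exp_add]; ring_nf; simp
    simp only [id]
    linear_combination δ * a + (1 - δ) * b
  rw [e1, ← Real.exp_add] at h'
  refine h'.trans_eq ?_
  congr 1
  norm_num
  ring

/-- If the joint probabilities of Boolean variables are dominated by those of independent Bernoulli
variables of mean `δ`, then so is the moment generating function of their sum. -/
lemma mgf_sum_bool_le {Ω ι : Type*} [MeasurableSpace Ω] [Fintype ι] (μ : Measure Ω)
    [IsFiniteMeasure μ] {X : ι → Ω → Bool} (hX : ∀ i, Measurable (X i)) {δ : ℝ}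
    (hsub : ∀ S : Finset ι, μ.real {ω | ∀ i ∈ S, X i ω = true} ≤ δ ^ S.card)
    {t : ℝ} (ht : 0 ≤ t) :
    ProbabilityTheory.mgf (fun ω ↦ ∑ i, if X i ω then (1 : ℝ) else 0) μ t ≤
      (1 + (Real.exp t - 1) * δ) ^ Fintype.card ι := by
  classical
  have hmeas (S : Finset ι) : MeasurableSet {ω | ∀ i ∈ S, X i ω = true} := by
    simp only [Set.ofPred_forall]
    exact S.measurableSet_biInter fun i _ ↦ hX i (measurableSet_singleton true)
  have hexp (ω : Ω) : Real.exp (t * ∑ i, if X i ω then (1 : ℝ) else 0) =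
      ∑ S : Finset ι, {ω | ∀ i ∈ S, X i ω = true}.indicator
        (fun _ ↦ (Real.exp t - 1) ^ S.card) ω := by
    calc Real.exp (t * ∑ i, if X i ω then (1 : ℝ) else 0)
        = ∏ i, (1 + if X i ω then Real.exp t - 1 else 0) := by
          rw [Finset.mul_sum, Real.exp_sum]
          refine Finset.prod_congr rfl fun i _ ↦ ?_
          split_ifs <;> simp
      _ = _ := by
          rw [Finset.prod_one_add, Finset.powerset_univ]
          refine Finset.sum_congr rfl fun S _ ↦ ?_
          rw [Finset.prod_ite_zero, Finset.prod_const]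
          simp [Set.indicator_apply]
  calc ProbabilityTheory.mgf (fun ω ↦ ∑ i, if X i ω then (1 : ℝ) else 0) μ t
      = ∑ S : Finset ι, μ.real {ω | ∀ i ∈ S, X i ω = true} * (Real.exp t - 1) ^ S.card := by
        simp_rw [ProbabilityTheory.mgf, hexp]
        rw [integral_finsetSum _ fun S _ ↦ (integrable_const _).indicator (hmeas S)]
        exact Finset.sum_congr rfl fun S _ ↦ by rw [integral_indicator_const _ (hmeas S), smul_eq_mul]
    _ ≤ ∑ S : Finset ι, ((Real.exp t - 1) * δ) ^ S.card := by
        refine Finset.sum_le_sum fun S _ ↦ ?_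
        rw [mul_pow, mul_comm]
        exact mul_le_mul_of_nonneg_left (hsub S)
          (pow_nonneg (sub_nonneg.2 (Real.one_le_exp ht)) _)
    _ = (1 + (Real.exp t - 1) * δ) ^ Fintype.card ι := by
        have h := Finset.prod_one_add (f := fun _ : ι ↦ (Real.exp t - 1) * δ) Finset.univ
        simpa using h.symm

/-- Fact 2.2 (generalized Chernoff bound, Panconesi–Srinivasan): if `X₁, …, Xₙ` are Boolean
random variables (not necessarily independent) such that for every subset `S ⊆ [n]`,
`Pr[∀ i ∈ S, Xᵢ = 1] ≤ δ^{|S|}`, then for every `γ ∈ [δ, 1]`,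
`Pr[Σᵢ Xᵢ ≥ γn] ≤ e^{−2(γ−δ)²n}`. -/
theorem generalized_chernoff {Ω : Type} [MeasurableSpace Ω]
    (μpr : Measure Ω) [IsProbabilityMeasure μpr]
    (n : ℕ) (hn : 1 ≤ n) (X : Fin n → Ω → Bool) (hXmeas : ∀ i, Measurable (X i))
    (δ : ℝ) (hδ0 : 0 ≤ δ) (hδ1 : δ ≤ 1)
    (hsub : ∀ S : Finset (Fin n),
      (μpr {ω | ∀ i ∈ S, X i ω = true}).toReal ≤ δ ^ S.card)
    (γ : ℝ) (hγδ : δ ≤ γ) (hγ1 : γ ≤ 1) :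
    (μpr {ω | γ * n ≤ ∑ i, (if X i ω then (1 : ℝ) else 0)}).toReal ≤
      Real.exp (-2 * (γ - δ) ^ 2 * n) := by
  have ht : 0 ≤ 4 * (γ - δ) := by linarith
  have hint : Integrable (fun ω ↦ Real.exp (4 * (γ - δ) * ∑ i, if X i ω then (1 : ℝ) else 0))
      μpr := by
    have hm : Measurable fun ω ↦ ∑ i, if X i ω then (1 : ℝ) else 0 :=
      Finset.measurable_fun_sum _ fun i _ ↦
        Measurable.ite (hXmeas i (measurableSet_singleton true)) measurable_const measurable_const
    refine Integrable.of_bound (hm.const_mul _).exp.aestronglyMeasurable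
      (Real.exp (4 * (γ - δ) * n)) (.of_forall fun ω ↦ ?_)
    rw [Real.norm_eq_abs, Real.abs_exp]
    refine Real.exp_le_exp.2 (mul_le_mul_of_nonneg_left ?_ ht)
    calc ∑ i, (if X i ω then (1 : ℝ) else 0) ≤ ∑ _i : Fin n, (1 : ℝ) :=
          Finset.sum_le_sum fun i _ ↦ by split_ifs <;> norm_num
      _ = n := by simp
  have hbase : 0 ≤ 1 + (Real.exp (4 * (γ - δ)) - 1) * δ :=
    add_nonneg zero_le_one (mul_nonneg (sub_nonneg.2 (Real.one_le_exp ht)) hδ0)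
  have hmgf := mgf_sum_bool_le μpr hXmeas hsub ht
  rw [Fintype.card_fin] at hmgf
  calc (μpr {ω | γ * n ≤ ∑ i, (if X i ω then (1 : ℝ) else 0)}).toReal
      ≤ Real.exp (-(4 * (γ - δ)) * (γ * n)) *
          ProbabilityTheory.mgf (fun ω ↦ ∑ i, if X i ω then (1 : ℝ) else 0) μpr (4 * (γ - δ)) :=
        ProbabilityTheory.measure_ge_le_exp_mul_mgf _ ht hint
    _ ≤ Real.exp (-(4 * (γ - δ)) * (γ * n)) *
          Real.exp (4 * (γ - δ) * δ + (4 * (γ - δ)) ^ 2 / 8) ^ n := by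
        gcongr
        exact hmgf.trans (pow_le_pow_left₀ hbase (one_add_exp_sub_one_mul_le_exp hδ0 hδ1 _) n)
    _ = Real.exp (-2 * (γ - δ) ^ 2 * n) := by
        rw [← Real.exp_nat_mul, ← Real.exp_add]
        ring_nf
end
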